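/- There exists n₀ such that for every perfect square n = N² with n ≥ n₀, the number of pairs of integers (a, b) with a² + b² = n and |b| < n^{1/4}·(log n)^{1/7} is at most ten. -/

import Mathlib

open Real

open Polynomial in
theorem exponential_polynomial_no_zeros {α β : Type*} (T : Finset ℕ) (hT : T.Nonempty)
    (P : ℕ → ℝ[X]) (hP : ∀ l ∈ T, P l ≠ 0) (L d : ℕ) (hTL : ∀ l ∈ T, l < L)
    (hd : ∀ l ∈ T, (P l).natDegree ≤ d)
    (J : Finset α) (x y : α → ℝ) (hy : Set.InjOn y J) (hJ : L ≤ J.card)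
    (I : Finset β) (u v : β → ℝ) (hu : Set.InjOn u I) (hv : ∀ i ∈ I, v i ≠ 0)
    (hI : L * d < I.card)
    (h : ∀ i ∈ I, ∀ j ∈ J, ∑ l ∈ T, (P l).eval (u i + x j) * (v i * y j) ^ l = 0) : False := by
  classical
  let G : Matrix T T ℝ[X] := fun a b =>
    ∑ j ∈ J, C (y j ^ (a : ℕ) * y j ^ (b : ℕ)) * taylor (x j) (P b)
  have hGdeg : ∀ a b, (G a b).natDegree ≤ d := by
    intro a b
    refine natDegree_sum_le_of_forall_le _ _ fun j _ => ?_
    refine (natDegree_C_mul_le _ _).trans ?_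
    rw [natDegree_taylor]
    exact hd b b.2
  have hTc : T.card ≤ L := by
    simpa using Finset.card_le_card (t := Finset.range L) fun l hl => Finset.mem_range.2 (hTL l hl)
  have hdet_deg : G.det.natDegree ≤ L * d := by
    rw [Matrix.det_apply]
    refine natDegree_sum_le_of_forall_le _ _ fun σ _ => ?_
    refine (natDegree_smul_le _ _).trans ((natDegree_prod_le _ _).trans ?_)
    refine (Finset.sum_le_sum fun i _ => hGdeg _ _).trans ?_
    simp only [Finset.sum_const, Finset.card_univ, Fintype.card_coe, smul_eq_mul]
    gcongr
  have hroot : ∀ i ∈ I, G.det.eval (u i) = 0 := by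
    intro i hi
    rw [← coe_evalRingHom, RingHom.map_det]
    refine Matrix.exists_mulVec_eq_zero_iff.1 ⟨fun b => v i ^ (b : ℕ), ?_, ?_⟩
    · obtain ⟨l, hl⟩ := hT
      intro h0
      exact pow_ne_zero l (hv i hi) (congrFun h0 ⟨l, hl⟩)
    · ext a
      have : ∑ j ∈ J, y j ^ (a : ℕ) *
          ∑ l ∈ T, (P l).eval (u i + x j) * (v i * y j) ^ l = 0 :=
        Finset.sum_eq_zero fun j hj => by rw [h i hi j hj, mul_zero]
      change ∑ b : T, (G a b).eval (u i) * v i ^ (b : ℕ) = 0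
      simp only [G, eval_finsetSum, eval_mul, eval_C, taylor_eval, Finset.sum_mul]
      rw [Finset.sum_comm, ← this]
      refine Finset.sum_congr rfl fun j _ => ?_
      rw [Finset.mul_sum, ← Finset.sum_coe_sort T]
      refine Finset.sum_congr rfl fun l _ => ?_
      ring
  have hdet : G.det = 0 := by
    refine eq_zero_of_natDegree_lt_card_of_eval_eq_zero' _ (I.image u) ?_ ?_
    · intro r hr
      obtain ⟨i, hi, rfl⟩ := Finset.mem_image.1 hr
      exact hroot i hi
    · rw [Finset.card_image_of_injOn hu]
      omega
  let G' : Matrix T T ℝ[X] := fun a b => X ^ (d - (P b).natDegree) * G a b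
  have hG' : G'.det = 0 := by
    have := Matrix.det_mul_row (fun b : T => (X : ℝ[X]) ^ (d - (P b).natDegree)) G
    rw [hdet, mul_zero] at this
    exact this
  have hG'deg : ∀ a b, (G' a b).natDegree ≤ d := by
    intro a b
    refine natDegree_mul_le.trans ?_
    have h1 : (G a b).natDegree ≤ (P b).natDegree := by
      refine natDegree_sum_le_of_forall_le _ _ fun j _ => ?_
      refine (natDegree_C_mul_le _ _).trans ?_
      rw [natDegree_taylor]
    have := hd b b.2
    simp only [natDegree_X_pow]
    omega
  have hcoeff : ∀ a b, (G' a b).coeff d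
      = (P b).leadingCoeff * ∑ j ∈ J, y j ^ (a : ℕ) * y j ^ (b : ℕ) := by
    intro a b
    have hdb := hd b b.2
    have : d = (P b).natDegree + (d - (P b).natDegree) := by omega
    have h2 : (G' a b).coeff d = (G a b).coeff (P b).natDegree := by
      conv_lhs => rw [this]
      exact coeff_X_pow_mul _ _ _
    rw [h2, finsetSum_coeff, Finset.mul_sum]
    refine Finset.sum_congr rfl fun j _ => ?_
    rw [coeff_C_mul, mul_comm]
    congr 1
    rw [← leadingCoeff_taylor (x j), leadingCoeff, natDegree_taylor]
  have hcd : (Matrix.of fun a b : T => (G' a b).coeff d).det = 0 := by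
    have h0 : G'.det.coeff (Fintype.card T * d) = 0 := by rw [hG', coeff_zero]
    rw [Matrix.det_apply, finsetSum_coeff] at h0
    rw [Matrix.det_apply, ← h0]
    refine Finset.sum_congr rfl fun σ _ => ?_
    rw [coeff_smul]
    congr 1
    rw [← Finset.card_univ, coeff_prod_of_natDegree_le _ _ _ fun a _ => hG'deg _ _]
    rfl
  let M : Matrix T T ℝ := Matrix.of fun a b => ∑ j ∈ J, y j ^ (a : ℕ) * y j ^ (b : ℕ)
  have hM : M.det = 0 := by
    have h1 := Matrix.det_mul_row (fun b : T => (P b).leadingCoeff) M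
    have h2 : (Matrix.of fun a b : T => (P b).leadingCoeff * M a b) =
        Matrix.of fun a b : T => (G' a b).coeff d := by
      ext a b
      simp [hcoeff, M]
    rw [h2, hcd] at h1
    refine (mul_eq_zero.1 h1.symm).resolve_left ?_
    exact Finset.prod_ne_zero_iff.2 fun b _ => leadingCoeff_ne_zero.2 (hP b b.2)
  obtain ⟨c, hc0, hc⟩ := Matrix.exists_mulVec_eq_zero_iff.2 hM
  have hq : ∀ j ∈ J, ∑ b : T, c b * y j ^ (b : ℕ) = 0 := by
    have h1 : ∑ j ∈ J, (∑ b : T, c b * y j ^ (b : ℕ)) ^ 2 = 0 := by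
      have h2 : ∑ a : T, c a * (M.mulVec c) a = 0 := by simp [hc]
      rw [← h2]
      simp only [Matrix.mulVec, dotProduct, M, Matrix.of_apply, sq, Finset.sum_mul, Finset.mul_sum]
      rw [Finset.sum_comm]
      refine Finset.sum_congr rfl fun a _ => ?_
      rw [Finset.sum_comm]
      refine Finset.sum_congr rfl fun b _ => ?_
      refine Finset.sum_congr rfl fun j _ => ?_
      ring
    intro j hj
    exact pow_eq_zero_iff (two_ne_zero) |>.1
      ((Finset.sum_eq_zero_iff_of_nonneg fun j _ => sq_nonneg _).1 h1 j hj)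
  let Q : ℝ[X] := ∑ b : T, C (c b) * X ^ (b : ℕ)
  have hQ : Q = 0 := by
    refine eq_zero_of_degree_lt_of_eval_finset_eq_zero (J.image y) ?_ ?_
    · refine (degree_sum_le _ _).trans_lt ?_
      rw [Finset.card_image_of_injOn hy]
      refine (Finset.sup_lt_iff (WithBot.bot_lt_coe _)).2 fun b _ => ?_
      refine (degree_C_mul_X_pow_le _ _).trans_lt ?_
      exact_mod_cast (hTL b b.2).trans_le hJ
    · intro r hr
      obtain ⟨j, hj, rfl⟩ := Finset.mem_image.1 hr
      simpa [Q, eval_finsetSum] using hq j hj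
  apply hc0
  ext b
  have := congrArg (fun q => coeff q (b : ℕ)) hQ
  simpa [Q, finsetSum_coeff, coeff_X_pow, Subtype.val_inj, eq_comm] using this

theorem sum_range_le_sum_of_injective_below {N : ℕ} (f : Fin N → Fin (N + 1))
    (hf : ∀ i j, (f i : ℕ) < N → f i = f j → i = j) :
    ∑ m ∈ Finset.range N, m ≤ ∑ i, (f i : ℕ) := by
  have h1 : ∀ i, (f i : ℕ) = ∑ t ∈ Finset.range N, if t < (f i : ℕ) then 1 else 0 := by
    intro i
    rw [← Finset.card_filter]
    have : (Finset.range N).filter (· < (f i : ℕ)) = Finset.range (f i) := by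
      ext t
      have := (f i).is_lt
      simp only [Finset.mem_filter, Finset.mem_range]
      omega
    rw [this, Finset.card_range]
  rw [Finset.sum_congr rfl fun i _ => h1 i, Finset.sum_comm, ← Finset.sum_range_reflect]
  refine Finset.sum_le_sum fun t ht => ?_
  rw [← Finset.card_filter]
  have htN := Finset.mem_range.1 ht
  have h2 := Finset.card_filter_add_card_filter_not (s := (Finset.univ : Finset (Fin N)))
    (fun i => t < (f i : ℕ))
  have h3 : (Finset.univ.filter fun i => ¬ t < (f i : ℕ)).card ≤ t + 1 := by
    rw [← Finset.card_range (t + 1)]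
    refine Finset.card_le_card_of_injOn (fun i => (f i : ℕ)) ?_ ?_
    · intro i hi
      simp at hi ⊢
      omega
    · intro i hi j hj hij
      simp at hi hj
      exact hf i j (by omega) (Fin.ext hij)
  simp at h2
  simp at h3 ⊢
  omega

theorem abs_det_le_factorial_mul_prod {N : ℕ} (A : Matrix (Fin N) (Fin N) ℝ) (M : Fin N → ℝ)
    (hA : ∀ i j, |A i j| ≤ M i) : |A.det| ≤ N.factorial * ∏ i, M i := by
  rw [← Matrix.det_transpose, Matrix.det_apply]
  refine (Finset.abs_sum_le_sum_abs _ _).trans ?_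
  have : ∀ σ ∈ (Finset.univ : Finset (Equiv.Perm (Fin N))),
      |Equiv.Perm.sign σ • ∏ i, A.transpose (σ i) i| ≤ ∏ i, M i := by
    intro σ _
    rw [Units.smul_def, zsmul_eq_mul, abs_mul, Finset.abs_prod]
    have h1 : |((Equiv.Perm.sign σ : ℤ) : ℝ)| = 1 := by
      rcases Int.units_eq_one_or (Equiv.Perm.sign σ) with h | h <;> simp [h]
    rw [h1, one_mul]
    exact Finset.prod_le_prod (fun _ _ => abs_nonneg _) fun i _ => hA _ _
  refine (Finset.sum_le_sum this).trans ?_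
  simp [Fintype.card_perm]

theorem abs_det_le_of_row_expansion {N : ℕ} (A : Matrix (Fin N) (Fin N) ℝ) (ρ : ℝ) (hρ : 1 ≤ ρ)
    (M : Fin N → ℝ) (c : Fin N → ℕ → ℝ) (w : ℕ → Fin N → ℝ)
    (hw : ∀ m j, |w m j| ≤ 1) (hc : ∀ i, ∀ m < N, |c i m| ≤ M i / ρ ^ m)
    (hA : ∀ i j, |A i j - ∑ m ∈ Finset.range N, c i m * w m j| ≤ M i / ρ ^ N) :
    |A.det| * ρ ^ (∑ m ∈ Finset.range N, m) ≤ (N + 1) ^ N * (N.factorial * ∏ i, M i) := by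
  classical
  have hρ0 : 0 < ρ := by linarith
  rcases Nat.eq_zero_or_pos N with rfl | hN
  · simp
  have hM : ∀ i, 0 ≤ M i := fun i => by
    simpa using (abs_nonneg _).trans (hc i 0 hN)
  let θ : Fin N → Fin N → ℝ := fun i j => A i j - ∑ m ∈ Finset.range N, c i m * w m j
  let s : Fin N → Fin (N + 1) → ℝ := fun i m => if (m : ℕ) < N then c i m else 1
  let r : Fin N → Fin (N + 1) → Fin N → ℝ := fun i m => if (m : ℕ) < N then w m else θ i
  have hrow : A = fun i => ∑ m : Fin (N + 1), s i m • r i m := by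
    ext i j
    rw [Finset.sum_apply, Fin.sum_univ_castSucc]
    simp [s, r, θ, Finset.sum_range]
  have hexp : A.det = ∑ f : Fin N → Fin (N + 1), Matrix.det (fun i => s i (f i) • r i (f i)) := by
    conv_lhs => rw [hrow]
    exact (Matrix.detRowAlternating (n := Fin N) (R := ℝ)).toMultilinearMap.map_sum
      (fun i m => s i m • r i m)
  have hterm : ∀ f : Fin N → Fin (N + 1),
      |Matrix.det (fun i => s i (f i) • r i (f i))| * ρ ^ (∑ m ∈ Finset.range N, m)
        ≤ N.factorial * ∏ i, M i := by
    intro f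
    have hP : 0 ≤ (N.factorial : ℝ) * ∏ i, M i :=
      mul_nonneg (by positivity) (Finset.prod_nonneg fun i _ => hM i)
    by_cases hf : ∀ i j, (f i : ℕ) < N → f i = f j → i = j
    · have hb := abs_det_le_factorial_mul_prod (fun i => s i (f i) • r i (f i))
        (fun i => M i / ρ ^ (f i : ℕ)) (by
          intro i j
          by_cases h : (f i : ℕ) < N
          · simp only [s, r, h, if_true, Pi.smul_apply, smul_eq_mul, abs_mul]
            calc _ ≤ M i / ρ ^ (f i : ℕ) * 1 :=
                  mul_le_mul (hc i _ h) (hw _ _) (abs_nonneg _)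
                    (div_nonneg (hM i) (by positivity))
              _ = _ := mul_one _
          · have hfi : (f i : ℕ) = N := by have := (f i).is_lt; omega
            simp only [s, r, hfi, lt_irrefl, if_false, one_smul]
            exact hA i j)
      have hs := sum_range_le_sum_of_injective_below f hf
      rw [Finset.prod_div_distrib, Finset.prod_pow_eq_pow_sum] at hb
      calc _ ≤ (N.factorial * ((∏ i, M i) / ρ ^ (∑ i, (f i : ℕ)))) * ρ ^ (∑ i, (f i : ℕ)) := by
            gcongr
            exact (abs_nonneg _).trans hb
        _ = _ := by field_simp
    · push Not at hf
      obtain ⟨i, j, hi, hij, hne⟩ := hf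
      have h0 : Matrix.det (fun i => s i (f i) • r i (f i)) = 0 := by
        have h1 := Matrix.det_mul_column (fun i => s i (f i)) (fun i => r i (f i))
        have h2 : Matrix.det (fun i => r i (f i)) = 0 := by
          refine Matrix.det_zero_of_row_eq hne ?_
          rw [← hij]
          simp only [r, hi, if_true]
        rw [h2, mul_zero] at h1
        exact h1
      rw [h0]
      simpa using hP
  rw [hexp]
  calc _ ≤ (∑ f : Fin N → Fin (N + 1), |Matrix.det (fun i => s i (f i) • r i (f i))|) *
          ρ ^ (∑ m ∈ Finset.range N, m) := by
        gcongr
        exact Finset.abs_sum_le_sum_abs _ _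
    _ ≤ ∑ f : Fin N → Fin (N + 1), (N.factorial : ℝ) * ∏ i, M i := by
        rw [Finset.sum_mul]
        exact Finset.sum_le_sum fun f _ => hterm f
    _ = _ := by simp

theorem exists_det_ne_zero_of_span_eq_top {N : ℕ} (s : Set (Fin N → ℝ))
    (hs : ∀ φ : Fin N → ℝ, (∀ v ∈ s, ∑ i, φ i * v i = 0) → φ = 0) :
    ∃ g : Fin N → Fin N → ℝ, (∀ j, g j ∈ s) ∧ (Matrix.of g).det ≠ 0 := by
  have htop : Submodule.span ℝ s = ⊤ := by
    by_contra hne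
    obtain ⟨f, hf0, hf⟩ := Submodule.exists_le_ker_of_lt_top _ (lt_top_iff_ne_top.2 hne)
    have hfv : ∀ v, f v = ∑ i, f (Pi.single i 1) * v i := by
      intro v
      rw [LinearMap.pi_apply_eq_sum_univ f v]
      refine Finset.sum_congr rfl fun i _ => ?_
      rw [smul_eq_mul, mul_comm]
      congr 2
      ext j
      simp [Pi.single_apply, eq_comm]
    have h0 := hs (fun i => f (Pi.single i 1)) fun v hv => by
      rw [← hfv]
      exact hf (Submodule.subset_span hv)
    apply hf0
    ext1 i
    ext
    simpa using congrFun h0 i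
  obtain ⟨g, hg, -, hlin⟩ := Submodule.exists_fun_fin_finrank_span_eq ℝ s
  have hN : Module.finrank ℝ (Submodule.span ℝ s) = N := by rw [htop]; simp
  refine ⟨fun j => g (Fin.cast hN.symm j), fun j => hg _, ?_⟩
  have h2 : LinearIndependent ℝ fun j => g (Fin.cast hN.symm j) :=
    hlin.comp _ (Fin.cast_injective hN.symm)
  have h3 := Matrix.linearIndependent_rows_iff_isUnit.1
    (show LinearIndependent ℝ (Matrix.of fun j => g (Fin.cast hN.symm j)).row from h2)
  exact ((Matrix.isUnit_iff_isUnit_det _).1 h3).ne_zero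

theorem abs_exp_sub_sum_le (x ρ : ℝ) (hρ : 1 ≤ ρ) (n : ℕ) :
    |exp x - ∑ m ∈ Finset.range n, x ^ m / m.factorial| ≤ exp (ρ * |x|) / ρ ^ n := by
  have hρ0 : 0 < ρ := by linarith
  have h1 : ∀ y : ℝ, HasSum (fun m : ℕ => y ^ m / m.factorial) (exp y) := by
    intro y
    rw [Real.exp_eq_exp_ℝ]
    exact NormedSpace.expSeries_div_hasSum_exp y
  have h2 := (hasSum_nat_add_iff' n).2 (h1 x)
  have h3 := ((hasSum_nat_add_iff' n).2 (h1 (ρ * |x|))).div_const (ρ ^ n)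
  rw [← h2.tsum_eq]
  have h4 : ∀ m : ℕ, ‖x ^ (m + n) / ((m + n).factorial : ℝ)‖ ≤
      (ρ * |x|) ^ (m + n) / ((m + n).factorial : ℝ) / ρ ^ n := by
    intro m
    rw [norm_div, norm_pow, Real.norm_eq_abs, Real.norm_natCast, div_right_comm]
    gcongr
    rw [le_div_iff₀ (by positivity), mul_pow, mul_comm, pow_add ρ]
    gcongr
    exact le_mul_of_one_le_left (by positivity) (one_le_pow₀ hρ)
  refine (tsum_of_norm_bounded h3 h4).trans ?_
  gcongr
  have : 0 ≤ ∑ i ∈ Finset.range n, (ρ * |x|) ^ i / (i.factorial : ℝ) :=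
    Finset.sum_nonneg fun i _ => by positivity
  linarith

theorem monomial_mul_exp_coeff_bound (Z a ρ : ℝ) (hZ : 0 ≤ Z) (hρ : 1 ≤ ρ) (k m : ℕ) (hk : k ≤ m) :
    |Z ^ k * ((a * Z) ^ (m - k) / (m - k).factorial)| ≤
      (ρ * Z) ^ k * exp (ρ * (|a| * Z)) / ρ ^ m := by
  have hρ0 : 0 < ρ := by linarith
  obtain ⟨t, rfl⟩ := Nat.exists_eq_add_of_le hk
  have h := Real.pow_div_factorial_le_exp (ρ * (|a| * Z)) (by positivity) t
  rw [abs_mul, abs_div, abs_pow, abs_pow, abs_mul, abs_of_nonneg hZ, Nat.abs_cast,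
    Nat.add_sub_cancel_left, le_div_iff₀ (by positivity), pow_add, mul_pow ρ Z]
  rw [mul_pow, mul_div_assoc] at h
  calc _ = ρ ^ k * Z ^ k * (ρ ^ t * ((|a| * Z) ^ t / (t.factorial : ℝ))) := by ring
    _ ≤ _ := by gcongr

theorem abs_monomial_mul_exp_sub_sum_le (Z a ρ z : ℝ) (hZ : 0 < Z) (hz : |z| ≤ Z) (hρ : 1 ≤ ρ)
    (k N : ℕ) (hk : k ≤ N) :
    |z ^ k * exp (a * z) - ∑ m ∈ Finset.range N,
      (if k ≤ m then Z ^ k * ((a * Z) ^ (m - k) / (m - k).factorial) else 0) * (z / Z) ^ m| ≤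
      (ρ * Z) ^ k * exp (ρ * (|a| * Z)) / ρ ^ N := by
  have hρ0 : 0 < ρ := by linarith
  obtain ⟨n, rfl⟩ := Nat.exists_eq_add_of_le hk
  have h1 : ∑ m ∈ Finset.range (k + n),
      (if k ≤ m then Z ^ k * ((a * Z) ^ (m - k) / (m - k).factorial) else 0) * (z / Z) ^ m
      = z ^ k * ∑ t ∈ Finset.range n, (a * z) ^ t / t.factorial := by
    rw [Finset.sum_range_add, Finset.sum_eq_zero, zero_add, Finset.mul_sum]
    · refine Finset.sum_congr rfl fun t _ => ?_
      rw [if_pos (Nat.le_add_right _ _), Nat.add_sub_cancel_left, pow_add, div_pow, div_pow,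
        mul_pow, mul_pow]
      field_simp
    · intro m hm
      rw [if_neg (by simpa using hm), zero_mul]
  rw [h1, ← mul_sub, abs_mul, abs_pow]
  calc |z| ^ k * |exp (a * z) - ∑ t ∈ Finset.range n, (a * z) ^ t / (t.factorial : ℝ)|
      ≤ Z ^ k * (exp (ρ * (|a| * Z)) / ρ ^ n) := by
        refine mul_le_mul (by gcongr) ((abs_exp_sub_sum_le _ ρ hρ n).trans ?_)
          (abs_nonneg _) (by positivity)
        rw [abs_mul]
        gcongr
    _ = _ := by
        rw [mul_pow, pow_add]
        field_simp

theorem interpolation_det_upper_bound {N K L R S : ℕ} (l₁ l₂ : ℝ) (p q : ℤ) (hq : q ≠ 0)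
    (hL : 1 ≤ L) (hR : 1 ≤ R) (Z W : ℝ) (hZ : Z = R * |(q : ℝ)| + S * |(p : ℝ)|)
    (hW : R * |l₁| + S * |l₂| ≤ W) (hΛ : 2 * L * S * |p * l₁ + q * l₂| * exp N ≤ 1)
    (f : Fin N → ℕ × ℕ) (hf : ∀ j, (f j).1 < R ∧ (f j).2 < S) (k l : Fin N → ℕ)
    (hk : ∀ i, k i < K) (hl : ∀ i, l i < L) (hKN : K ≤ N) (A : Matrix (Fin N) (Fin N) ℝ)
    (hA : ∀ i j, A i j =
      ((f j).1 * (q : ℝ) - (f j).2 * p) ^ k i * exp (l i * ((f j).1 * l₁ + (f j).2 * l₂))) :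
    |A.det| * exp 1 ^ (∑ m ∈ Finset.range N, m) ≤ (N + 1) ^ N *
      (N.factorial * (2 * ((exp 1 * Z) ^ K * exp (exp 1 * (L * (W + 1))))) ^ N) := by
  set Λ := p * l₁ + q * l₂ with hΛdef
  have hq1 : 1 ≤ |(q : ℝ)| := by exact_mod_cast Int.one_le_abs hq
  have hR1 : (1 : ℝ) ≤ R := by exact_mod_cast hR
  have hL1 : (1 : ℝ) ≤ L := by exact_mod_cast hL
  have hZ1 : 1 ≤ Z := by
    have : 0 ≤ S * |(p : ℝ)| := by positivity
    nlinarith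
  have he : 1 ≤ exp 1 := by rw [← exp_zero]; exact exp_le_exp.2 (by norm_num)
  have heN : 1 ≤ exp N := by rw [← exp_zero]; exact exp_le_exp.2 (Nat.cast_nonneg _)
  have hSΛ : S * |Λ| ≤ 1 := by
    calc S * |Λ| = 1 * 1 * (S * |Λ|) * 1 := by ring
      _ ≤ 2 * L * (S * |Λ|) * exp N := by gcongr; norm_num
      _ = 2 * L * S * |Λ| * exp N := by ring
      _ ≤ 1 := hΛ
  have hcZ : |l₁ / q| * Z ≤ W + 1 := by
    have hpl : (l₁ / q) * p = Λ / q - l₂ := by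
      have : (q : ℝ) ≠ 0 := by exact_mod_cast hq
      field_simp
      rw [hΛdef]; ring
    have h1 : |l₁ / q| * |(q : ℝ)| = |l₁| := by
      rw [abs_div, div_mul_cancel₀]; positivity
    have h2 : |l₁ / q| * |(p : ℝ)| ≤ |Λ| + |l₂| := by
      rw [← abs_mul, hpl]
      refine (abs_sub _ _).trans ?_
      gcongr ?_ + _
      rw [abs_div]
      exact div_le_self (abs_nonneg _) hq1
    calc |l₁ / q| * Z = R * (|l₁ / q| * |(q : ℝ)|) + S * (|l₁ / q| * |(p : ℝ)|) := by rw [hZ]; ring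
      _ ≤ R * |l₁| + S * (|Λ| + |l₂|) := by rw [h1]; gcongr
      _ ≤ W + 1 := by linarith
  have hW1 : 0 ≤ W + 1 := le_trans (by positivity) hcZ
  set M := (exp 1 * Z) ^ K * exp (exp 1 * (L * (W + 1))) with hM
  have heZ : 1 ≤ exp 1 * Z := one_le_mul_of_one_le_of_one_le he hZ1
  have hlL : ∀ i, (l i : ℝ) ≤ L := fun i => by exact_mod_cast (hl i).le
  let z : Fin N → ℝ := fun j => (f j).1 * (q : ℝ) - (f j).2 * p
  have hz : ∀ j, |z j| ≤ Z := by
    intro j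
    have h1 : ((f j).1 : ℝ) ≤ R := by exact_mod_cast (hf j).1.le
    have h2 : ((f j).2 : ℝ) ≤ S := by exact_mod_cast (hf j).2.le
    calc |z j| ≤ |((f j).1 : ℝ) * q| + |((f j).2 : ℝ) * p| := abs_sub _ _
      _ ≤ Z := by
        rw [abs_mul, abs_mul, Nat.abs_cast, Nat.abs_cast, hZ]
        gcongr
  have hcl : ∀ i, |l i * (l₁ / q)| * Z ≤ L * (W + 1) := by
    intro i
    rw [abs_mul, Nat.abs_cast, mul_assoc]
    exact mul_le_mul (hlL i) hcZ (by positivity) (by positivity)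
  have hMle : ∀ i, (exp 1 * Z) ^ k i * exp (exp 1 * (|l i * (l₁ / q)| * Z)) ≤ M := by
    intro i
    exact mul_le_mul (pow_le_pow_right₀ heZ (hk i).le)
      (exp_le_exp.2 (mul_le_mul_of_nonneg_left (hcl i) (by positivity))) (by positivity)
      (by positivity)
  have hM0 : 0 ≤ M := by positivity
  have main := abs_det_le_of_row_expansion A (exp 1) he (fun _ => 2 * M)
    (fun i m => if k i ≤ m then
      Z ^ k i * ((l i * (l₁ / q) * Z) ^ (m - k i) / (m - k i).factorial) else 0)
    (fun m j => (z j / Z) ^ m) ?_ ?_ ?_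
  · simpa using main
  · intro m j
    rw [abs_pow, abs_div, abs_of_pos (by linarith : 0 < Z)]
    exact pow_le_one₀ (by positivity) (div_le_one_of_le₀ (hz j) (by linarith))
  · intro i m _
    split_ifs with h
    · refine (monomial_mul_exp_coeff_bound Z _ (exp 1) (by linarith) he _ _ h).trans ?_
      refine div_le_div_of_nonneg_right ?_ (by positivity)
      linarith [hMle i]
    · simp only [abs_zero]; positivity
  · intro i j
    have hsplit : A i j = z j ^ k i * exp (l i * (l₁ / q) * z j) +
        z j ^ k i * exp (l i * (l₁ / q) * z j) * (exp (l i * (f j).2 * Λ / q) - 1) := by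
      rw [hA]
      have : (q : ℝ) ≠ 0 := by exact_mod_cast hq
      have h3 : (l i : ℝ) * ((f j).1 * l₁ + (f j).2 * l₂) =
          l i * (l₁ / q) * z j + l i * (f j).2 * Λ / q := by
        simp only [z, hΛdef]
        field_simp
        ring
      rw [h3, exp_add]
      ring
    have h1 := abs_monomial_mul_exp_sub_sum_le Z (l i * (l₁ / q)) (exp 1) (z j) (by linarith)
      (hz j) he (k i) N ((hk i).le.trans hKN)
    have h2 : |z j ^ k i * exp (l i * (l₁ / q) * z j) * (exp (l i * (f j).2 * Λ / q) - 1)| ≤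
        M / exp 1 ^ N := by
      have hx : |l i * (f j).2 * Λ / q| ≤ L * (S * |Λ|) := by
        have h2 : ((f j).2 : ℝ) ≤ S := by exact_mod_cast (hf j).2.le
        rw [abs_div, abs_mul, abs_mul, Nat.abs_cast, Nat.abs_cast]
        refine (div_le_self (by positivity) hq1).trans ?_
        rw [mul_assoc]
        have := hlL i
        gcongr
      have hx2 : 2 * (L * (S * |Λ|)) ≤ 1 / exp 1 ^ N := by
        rw [le_div_iff₀ (by positivity), ← exp_nat_mul, mul_one]
        linarith
      have hx3 : |l i * (f j).2 * Λ / q| ≤ 1 := by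
        have : 1 / exp 1 ^ N ≤ 1 := div_le_one_of_le₀ (one_le_pow₀ he) (by positivity)
        linarith [abs_nonneg (l i * (f j).2 * Λ / q)]
      have hx4 := Real.abs_exp_sub_one_le hx3
      rw [abs_mul, abs_mul, abs_pow, abs_of_pos (exp_pos _)]
      have hx5 : |z j| ^ k i ≤ (exp 1 * Z) ^ k i := by
        have := hz j
        gcongr
        exact this.trans (le_mul_of_one_le_left (by linarith) he)
      have hx6 : exp (l i * (l₁ / q) * z j) ≤ exp (exp 1 * (|l i * (l₁ / q)| * Z)) := by
        apply exp_le_exp.2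
        refine (le_abs_self _).trans ?_
        rw [abs_mul]
        calc _ ≤ |l i * (l₁ / q)| * Z := by have := hz j; gcongr
          _ ≤ _ := le_mul_of_one_le_left (by positivity) he
      calc _ ≤ (exp 1 * Z) ^ k i * exp (exp 1 * (|l i * (l₁ / q)| * Z)) * (1 / exp 1 ^ N) := by
            gcongr
            linarith
        _ ≤ M * (1 / exp 1 ^ N) := by have := hMle i; gcongr
        _ = _ := by ring
    have h3 : (exp 1 * Z) ^ k i * exp (exp 1 * (|l i * (l₁ / q)| * Z)) / exp 1 ^ N ≤
        M / exp 1 ^ N := by have := hMle i; gcongr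
    rw [hsplit, add_sub_right_comm]
    refine (abs_add_le _ _).trans ?_
    calc _ ≤ M / exp 1 ^ N + M / exp 1 ^ N := add_le_add (h1.trans h3) h2
      _ = _ := by ring

/-- A subring of a finite product of copies of `ℝ` in which an element that is nonzero at the
coordinate `o` has norm (product of the coordinates) at least `1` in absolute value. -/
def HasNormGeOne {ι : Type*} [Fintype ι] (S : Subring (ι → ℝ)) (o : ι) : Prop :=
  ∀ x ∈ S, x o ≠ 0 → 1 ≤ ∏ i, |x i|

/-- `x` and `x⁻¹` have a common denominator at most `exp h` with respect to `S`, and all their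
coordinates are bounded by `exp h`. -/
def HeightLE {ι : Type*} (S : Subring (ι → ℝ)) (h : ℝ) (x : ι → ℝ) : Prop :=
  (∃ q : ℕ, 0 < q ∧ (q : ℝ) ≤ exp h ∧ (q : ι → ℝ) * x ∈ S ∧ (q : ι → ℝ) * x⁻¹ ∈ S) ∧
    ∀ i, x i ≠ 0 ∧ |x i| ≤ exp h ∧ |(x i)⁻¹| ≤ exp h

section Height

variable {ι : Type*} {S : Subring (ι → ℝ)}

theorem HeightLE.one : HeightLE S 0 1 := by
  refine ⟨⟨1, one_pos, by simp, ?_, ?_⟩, fun i => by simp⟩ <;> simp [S.one_mem]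

theorem HeightLE.inv {h : ℝ} {x : ι → ℝ} (hx : HeightLE S h x) : HeightLE S h x⁻¹ := by
  obtain ⟨⟨q, hq, hqh, h1, h2⟩, h3⟩ := hx
  refine ⟨⟨q, hq, hqh, h2, by rwa [inv_inv]⟩, fun i => ?_⟩
  obtain ⟨a, b, c⟩ := h3 i
  exact ⟨inv_ne_zero a, c, by simpa using b⟩

theorem HeightLE.mul {h h' : ℝ} {x y : ι → ℝ} (hx : HeightLE S h x) (hy : HeightLE S h' y) :
    HeightLE S (h + h') (x * y) := by
  obtain ⟨⟨q, hq, hqh, h1, h2⟩, h3⟩ := hx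
  obtain ⟨⟨q', hq', hqh', h1', h2'⟩, h3'⟩ := hy
  refine ⟨⟨q * q', Nat.mul_pos hq hq', ?_, ?_, ?_⟩, fun i => ⟨?_, ?_, ?_⟩⟩
  · rw [exp_add, Nat.cast_mul]
    gcongr
  · have := S.mul_mem h1 h1'
    rwa [mul_mul_mul_comm, ← Nat.cast_mul] at this
  · have := S.mul_mem h2 h2'
    rwa [mul_mul_mul_comm, ← Nat.cast_mul, ← mul_inv] at this
  · exact mul_ne_zero (h3 i).1 (h3' i).1
  · rw [Pi.mul_apply, abs_mul, exp_add]
    exact mul_le_mul (h3 i).2.1 (h3' i).2.1 (abs_nonneg _) (exp_pos _).le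
  · rw [Pi.mul_apply, mul_inv, abs_mul, exp_add]
    exact mul_le_mul (h3 i).2.2 (h3' i).2.2 (abs_nonneg _) (exp_pos _).le

theorem HeightLE.mono {h h' : ℝ} {x : ι → ℝ} (hx : HeightLE S h x) (hh : h ≤ h') :
    HeightLE S h' x := by
  obtain ⟨⟨q, hq, hqh, h1, h2⟩, h3⟩ := hx
  have := exp_le_exp.2 hh
  exact ⟨⟨q, hq, hqh.trans this, h1, h2⟩,
    fun i => ⟨(h3 i).1, (h3 i).2.1.trans this, (h3 i).2.2.trans this⟩⟩

theorem HeightLE.pow {h : ℝ} {x : ι → ℝ} (hx : HeightLE S h x) (n : ℕ) :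
    HeightLE S (n * h) (x ^ n) := by
  induction n with
  | zero => simpa using HeightLE.one
  | succ n ih =>
    rw [pow_succ, Nat.cast_succ, add_mul, one_mul]
    exact ih.mul hx

theorem HeightLE.zpow {h : ℝ} {x : ι → ℝ} (hx : HeightLE S h x) (n : ℤ) :
    HeightLE S (|(n : ℝ)| * h) (x ^ n) := by
  rcases Int.eq_nat_or_neg n with ⟨m, rfl | rfl⟩
  · simpa using hx.pow m
  · simpa using (hx.pow m).inv

theorem HeightLE.nonneg [Nonempty ι] {h : ℝ} {x : ι → ℝ} (hx : HeightLE S h x) : 0 ≤ h := by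
  obtain ⟨⟨q, hq, hqh, -⟩, -⟩ := hx
  rw [← one_le_exp_iff]
  exact le_trans (by exact_mod_cast hq) hqh

theorem HeightLE.abs_log_le {h : ℝ} {x : ι → ℝ} (hx : HeightLE S h x) {i : ι} (hi : 0 < x i) :
    |log (x i)| ≤ h := by
  obtain ⟨-, h2, h3⟩ := hx.2 i
  rw [abs_of_pos hi] at h2
  rw [abs_of_pos (inv_pos.2 hi)] at h3
  rw [abs_le]
  constructor
  · have := (log_le_iff_le_exp (inv_pos.2 hi)).2 h3
    rw [log_inv] at this
    linarith
  · exact (log_le_iff_le_exp hi).2 h2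

theorem HeightLE.lower_bound_sub_one [Fintype ι] {o : ι} (hS : HasNormGeOne S o) {h : ℝ}
    {x : ι → ℝ} (hx : HeightLE S h x) (hxo : x o ≠ 1) :
    exp (-(Fintype.card ι * (2 * h + 1))) ≤ |x o - 1| := by
  classical
  have : Nonempty ι := ⟨o⟩
  have hh := hx.nonneg
  obtain ⟨⟨q, hq, hqh, h1, -⟩, h3⟩ := hx
  have hmem : (q : ι → ℝ) * x - (q : ι → ℝ) ∈ S := S.sub_mem h1 (natCast_mem S q)
  have hq0 : (0 : ℝ) < q := by exact_mod_cast hq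
  have hval : ∀ i, ((q : ι → ℝ) * x - (q : ι → ℝ)) i = q * (x i - 1) := by
    intro i
    simp
    ring
  have hL := hS _ hmem (by rw [hval]; exact mul_ne_zero hq0.ne' (sub_ne_zero.2 hxo))
  simp only [hval, abs_mul, Nat.abs_cast] at hL
  have hb : ∀ i, (q : ℝ) * |x i - 1| ≤ exp (2 * h + 1) := by
    intro i
    have h4 : |x i - 1| ≤ exp (h + 1) := by
      refine (abs_sub _ _).trans ?_
      rw [abs_one, exp_add]
      have := (h3 i).2.1
      have h5 := one_le_exp_iff.2 hh
      have h6 := add_one_le_exp (1 : ℝ)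
      nlinarith
    calc _ ≤ exp h * exp (h + 1) := by gcongr
      _ = _ := by rw [← exp_add]; ring_nf
  rw [← Finset.mul_prod_erase _ _ (Finset.mem_univ o)] at hL
  have h5 : ∏ i ∈ Finset.univ.erase o, (q : ℝ) * |x i - 1| ≤
      exp (2 * h + 1) ^ (Fintype.card ι - 1) := by
    refine (Finset.prod_le_prod (fun i _ => by positivity) fun i _ => hb i).trans_eq ?_
    rw [Finset.prod_const, Finset.card_erase_of_mem (Finset.mem_univ o), Finset.card_univ]
  have h6 : (1 : ℝ) ≤ exp (2 * h + 1) * |x o - 1| * exp (2 * h + 1) ^ (Fintype.card ι - 1) := by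
    refine hL.trans (mul_le_mul ?_ h5 (by positivity) (by positivity))
    refine mul_le_mul_of_nonneg_right (hqh.trans (exp_le_exp.2 (by linarith))) (abs_nonneg _)
  rw [exp_neg, inv_le_iff_one_le_mul₀ (exp_pos _), exp_nat_mul]
  refine h6.trans_eq ?_
  rw [← pow_sub_one_mul (Fintype.card_ne_zero (α := ι))]
  ring

end Height

theorem Subring.det_mem_of_forall_mem {R : Type*} [CommRing R] (S : Subring R) {n : Type*}
    [Fintype n] [DecidableEq n] (A : Matrix n n R) (hA : ∀ i j, A i j ∈ S) : A.det ∈ S := by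
  rw [Matrix.det_apply]
  exact S.sum_mem fun σ _ => by
    rw [Units.smul_def]
    exact S.zsmul_mem (S.prod_mem fun i _ => hA _ _) _

theorem interpolation_det_lower_bound {ι : Type*} [Fintype ι] {S : Subring (ι → ℝ)} {o : ι}
    (hS : HasNormGeOne S o) {h₁ h₂ : ℝ} {x y : ι → ℝ} (hx : HeightLE S h₁ x)
    (hy : HeightLE S h₂ y) {N K L R T : ℕ} (z : Fin N → ℤ) (Z W : ℝ) (hZ1 : 1 ≤ Z)
    (hz : ∀ j, |(z j : ℝ)| ≤ Z) (hW : W = R * h₁ + T * h₂)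
    (f : Fin N → ℕ × ℕ) (hf : ∀ j, (f j).1 < R ∧ (f j).2 < T) (k l : Fin N → ℕ)
    (hk : ∀ i, k i < K) (hl : ∀ i, l i < L)
    (hdet : (Matrix.of fun i j => (z j : ℝ) ^ k i * (x o ^ (f j).1 * y o ^ (f j).2) ^ l i).det ≠ 0) :
    1 ≤ exp (Fintype.card ι * (N * (L * W))) *
      |(Matrix.of fun i j => (z j : ℝ) ^ k i * (x o ^ (f j).1 * y o ^ (f j).2) ^ l i).det| *
      (N.factorial * (Z ^ K * exp (L * W)) ^ N) ^ (Fintype.card ι - 1) := by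
  classical
  have : Nonempty ι := ⟨o⟩
  have hh₁ := hx.nonneg
  have hh₂ := hy.nonneg
  obtain ⟨⟨q, hq, hqh, hqx, -⟩, hx'⟩ := hx
  obtain ⟨⟨q', hq', hqh', hqy, -⟩, hy'⟩ := hy
  let A : Matrix (Fin N) (Fin N) (ι → ℝ) :=
    Matrix.of fun i j => (z j : ι → ℝ) ^ k i * (x ^ (f j).1 * y ^ (f j).2) ^ l i
  let Q : ι → ℝ := (q : ι → ℝ) ^ (L * R) * (q' : ι → ℝ) ^ (L * T)
  have hQA : ∀ i j, (Q • A) i j ∈ S := by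
    intro i j
    have e1 : L * R = (f j).1 * l i + (L * R - (f j).1 * l i) := by
      have := Nat.mul_le_mul (hf j).1.le (hl i).le
      rw [mul_comm L R]
      omega
    have e2 : L * T = (f j).2 * l i + (L * T - (f j).2 * l i) := by
      have := Nat.mul_le_mul (hf j).2.le (hl i).le
      rw [mul_comm L T]
      omega
    have : (Q • A) i j = (z j : ι → ℝ) ^ k i * ((q : ι → ℝ) * x) ^ ((f j).1 * l i) *
        ((q' : ι → ℝ) * y) ^ ((f j).2 * l i) * (q : ι → ℝ) ^ (L * R - (f j).1 * l i) *
        (q' : ι → ℝ) ^ (L * T - (f j).2 * l i) := by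
      simp only [Matrix.smul_apply, A, Q, Matrix.of_apply, smul_eq_mul]
      conv_lhs => rw [e1, e2]
      simp only [mul_pow, pow_add, ← pow_mul]
      ring
    rw [this]
    exact S.mul_mem (S.mul_mem (S.mul_mem (S.mul_mem (S.pow_mem (intCast_mem S _) _)
      (S.pow_mem hqx _)) (S.pow_mem hqy _)) (S.pow_mem (natCast_mem S _) _))
      (S.pow_mem (natCast_mem S _) _)
  have hmem := S.det_mem_of_forall_mem _ hQA
  rw [Matrix.det_smul, Fintype.card_fin] at hmem
  have hval : ∀ i, A.det i =
      (Matrix.of fun a j => (z j : ℝ) ^ k a * (x i ^ (f j).1 * y i ^ (f j).2) ^ l a).det := by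
    intro i
    change Pi.evalRingHom (fun _ => ℝ) i A.det = _
    rw [RingHom.map_det]
    congr 1
  have hQval : ∀ i, Q i = (q : ℝ) ^ (L * R) * (q' : ℝ) ^ (L * T) := by
    intro i
    simp [Q]
  have hq0 : (0 : ℝ) < q := by exact_mod_cast hq
  have hq0' : (0 : ℝ) < q' := by exact_mod_cast hq'
  have hQle : (q : ℝ) ^ (L * R) * (q' : ℝ) ^ (L * T) ≤ exp (L * W) := by
    calc _ ≤ exp h₁ ^ (L * R) * exp h₂ ^ (L * T) := by gcongr
      _ = _ := by
        rw [← exp_nat_mul, ← exp_nat_mul, ← exp_add, hW]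
        push_cast
        ring_nf
  have hbound : ∀ i, |A.det i| ≤ N.factorial * (Z ^ K * exp (L * W)) ^ N := by
    intro i
    rw [hval]
    refine (abs_det_le_factorial_mul_prod _ (fun _ => Z ^ K * exp (L * W)) ?_).trans_eq (by simp)
    intro a j
    simp only [Matrix.of_apply, abs_mul, abs_pow]
    refine mul_le_mul ?_ ?_ (by positivity) (by positivity)
    · exact (pow_le_pow_left₀ (abs_nonneg _) (hz j) _).trans
        (pow_le_pow_right₀ hZ1 (hk a).le)
    · have hb : |x i| ^ (f j).1 * |y i| ^ (f j).2 ≤ exp W := by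
        have h1 : |x i| ^ (f j).1 ≤ exp (R * h₁) := by
          refine (pow_le_pow_left₀ (abs_nonneg _) (hx' i).2.1 _).trans ?_
          rw [← exp_nat_mul]
          have : ((f j).1 : ℝ) ≤ R := by exact_mod_cast (hf j).1.le
          gcongr
        have h2 : |y i| ^ (f j).2 ≤ exp (T * h₂) := by
          refine (pow_le_pow_left₀ (abs_nonneg _) (hy' i).2.1 _).trans ?_
          rw [← exp_nat_mul]
          have : ((f j).2 : ℝ) ≤ T := by exact_mod_cast (hf j).2.le
          gcongr
        rw [hW, exp_add]
        exact mul_le_mul h1 h2 (by positivity) (by positivity)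
      refine (pow_le_pow_left₀ (by positivity) hb _).trans ?_
      rw [← exp_nat_mul]
      have : (l a : ℝ) ≤ L := by exact_mod_cast (hl a).le
      have hW0 : 0 ≤ W := by rw [hW]; positivity
      gcongr
  have hne : (Q ^ N * A.det) o ≠ 0 := by
    rw [Pi.mul_apply, Pi.pow_apply, hQval, hval]
    exact mul_ne_zero (by positivity) hdet
  have hL := hS _ hmem hne
  have hsplit : ∏ i, |(Q ^ N * A.det) i| =
      (((q : ℝ) ^ (L * R) * (q' : ℝ) ^ (L * T)) ^ N) ^ Fintype.card ι *
        (|A.det o| * ∏ i ∈ Finset.univ.erase o, |A.det i|) := by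
    rw [Finset.mul_prod_erase _ (fun i => |A.det i|) (Finset.mem_univ o), ← Finset.card_univ,
      ← Finset.prod_const, ← Finset.prod_mul_distrib]
    refine Finset.prod_congr rfl fun i _ => ?_
    rw [Pi.mul_apply, Pi.pow_apply, hQval, abs_mul, abs_of_pos]
    positivity
  rw [hsplit] at hL
  refine hL.trans ?_
  rw [← hval o, mul_assoc (exp _)]
  have hprod : ∏ i ∈ Finset.univ.erase o, |A.det i| ≤
      (N.factorial * (Z ^ K * exp (L * W)) ^ N) ^ (Fintype.card ι - 1) := by
    refine (Finset.prod_le_prod (fun i _ => abs_nonneg _) fun i _ => hbound i).trans_eq ?_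
    rw [Finset.prod_const, Finset.card_erase_of_mem (Finset.mem_univ o), Finset.card_univ]
  have hexp : (((q : ℝ) ^ (L * R) * (q' : ℝ) ^ (L * T)) ^ N) ^ Fintype.card ι ≤
      exp (Fintype.card ι * (N * (L * W))) := by
    rw [exp_nat_mul, exp_nat_mul]
    gcongr
  gcongr

open Polynomial in
theorem eq_zero_of_forall_grid {N K L R T : ℕ} (k l : Fin N → ℕ)
    (hkl : Function.Injective fun i => (k i, l i)) (hk : ∀ i, k i < K) (hl : ∀ i, l i < L)
    (hK : 1 ≤ K) (hL : 1 ≤ L) (hKL : K * L ≤ R * T) (u : ℕ × ℕ → ℝ) (w : ℕ × ℕ → ℝ)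
    (hu : ∀ a b, u (a + b) = u a + u b) (hw : ∀ a b, w (a + b) = w a + w b)
    (hui : Set.InjOn u (Finset.range R ×ˢ Finset.range T))
    (hwi : Set.InjOn w (Finset.range R ×ˢ Finset.range T))
    (φ : Fin N → ℝ)
    (hφ : ∀ a : ℕ × ℕ, a.1 < 2 * R → a.2 < 2 * T →
      ∑ i, φ i * (u a ^ k i * exp (l i * w a)) = 0) : φ = 0 := by
  classical
  by_contra hne
  obtain ⟨i₀, hi₀⟩ : ∃ i, φ i ≠ 0 := by
    by_contra! h
    exact hne (funext h)
  let P : ℕ → ℝ[X] := fun m => ∑ i with l i = m, C (φ i) * X ^ k i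
  let J : Finset (ℕ × ℕ) := Finset.range R ×ˢ Finset.range T
  have hcard : J.card = R * T := by simp [J]
  have hJ : Set.InjOn u J := by simpa [J] using hui
  have hJ' : Set.InjOn w J := by simpa [J] using hwi
  have hP0 : P (l i₀) ≠ 0 := by
    intro h
    have h2 : (P (l i₀)).coeff (k i₀) = φ i₀ := by
      simp only [P, finsetSum_coeff, coeff_C_mul, coeff_X_pow]
      rw [Finset.sum_eq_single i₀]
      · simp
      · intro b hb hbi
        rw [if_neg, mul_zero]
        intro h3
        exact hbi (hkl (Prod.ext h3.symm (Finset.mem_filter.1 hb).2))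
      · simp
    rw [h, coeff_zero] at h2
    exact hi₀ h2.symm
  refine exponential_polynomial_no_zeros ((Finset.range L).filter fun m => P m ≠ 0)
    ⟨l i₀, by simp [hl, hP0]⟩ P (fun m hm => (Finset.mem_filter.1 hm).2) L (K - 1)
    (fun m hm => Finset.mem_range.1 (Finset.mem_filter.1 hm).1) ?_ J u (fun a => exp (w a))
    (fun a ha b hb hab => hJ' ha hb (exp_injective hab)) ?_ J u (fun a => exp (w a)) hJ
    (fun _ _ => exp_ne_zero _) ?_ ?_
  · intro m _
    refine natDegree_sum_le_of_forall_le _ _ fun i _ => (natDegree_C_mul_X_pow_le _ _).trans ?_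
    have := hk i
    omega
  · rw [hcard]
    exact (Nat.le_mul_of_pos_left _ hK).trans hKL
  · rw [hcard]
    refine lt_of_lt_of_le ?_ hKL
    rw [mul_comm K]
    exact Nat.mul_lt_mul_of_pos_left (by omega) hL
  · intro a ha b hb
    have ha' : a.1 < R ∧ a.2 < T := by simpa [J] using ha
    have hb' : b.1 < R ∧ b.2 < T := by simpa [J] using hb
    have h := hφ (a + b) (by simp; omega) (by simp; omega)
    rw [Finset.sum_filter_of_ne]
    · rw [← h, ← Finset.sum_fiberwise_of_maps_to (s := Finset.univ) (t := Finset.range L) (g := l)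
        (fun i _ => Finset.mem_range.2 (hl i))]
      refine Finset.sum_congr rfl fun m _ => ?_
      simp only [P, eval_finsetSum, Finset.sum_mul, eval_mul, eval_C, eval_pow, eval_X]
      refine Finset.sum_congr rfl fun i hi => ?_
      rw [← (Finset.mem_filter.1 hi).2, hu, hw, mul_add, exp_add, mul_pow, exp_nat_mul, exp_nat_mul]
      ring
    · intro m _ h0 h1
      rw [h1] at h0
      simp at h0

theorem HeightLE.false_of_abs_log_small {ι : Type*} [Fintype ι] {S : Subring (ι → ℝ)} {o : ι}
    (hS : HasNormGeOne S o) {h W B Λ : ℝ} {x : ι → ℝ} (hx : HeightLE S h x) (hxo : 0 < x o)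
    (hW : h ≤ W) (hΛ : Λ ≠ 0) (hΛ1 : 2 * B * |Λ| < exp (-(Fintype.card ι * (2 * W + 1))))
    {t c : ℤ} (ht : t ≠ 0) (hc : c ≠ 0) (hcB : |(c : ℝ)| ≤ B) (htl : t * log (x o) = c * Λ) :
    False := by
  have : Nonempty ι := ⟨o⟩
  have hW0 := hx.nonneg.trans hW
  have h1 : exp (-(Fintype.card ι * (2 * W + 1))) ≤ 1 := exp_le_one_iff.2 (by
    rw [neg_nonpos]; positivity)
  have ht1 : (1 : ℝ) ≤ |(t : ℝ)| := by exact_mod_cast Int.one_le_abs ht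
  have h2 : |log (x o)| ≤ B * |Λ| := by
    calc |log (x o)| ≤ |(t : ℝ)| * |log (x o)| := le_mul_of_one_le_left (abs_nonneg _) ht1
      _ = |(c : ℝ)| * |Λ| := by rw [← abs_mul, htl, abs_mul]
      _ ≤ _ := by gcongr
  have h3 : log (x o) ≠ 0 := by
    intro h0
    rw [h0, mul_zero] at htl
    exact mul_ne_zero (Int.cast_ne_zero.2 hc) hΛ htl.symm
  have h4 : x o ≠ 1 := fun h => h3 (by rw [h, log_one])
  have h5 := (hx.mono hW).lower_bound_sub_one hS h4
  have h6 := abs_exp_sub_one_le (x := log (x o)) (by linarith [abs_nonneg (log (x o))])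
  rw [exp_log hxo] at h6
  linarith

theorem false_of_det_bounds {N K L d : ℕ} {D Z W : ℝ} (hdp : 0 < D) (hNN : 1 ≤ N) (hd1 : 1 ≤ d)
    (hZ1 : 1 ≤ Z)
    (hup : D * exp 1 ^ (∑ m ∈ Finset.range N, m) ≤ (N + 1) ^ N *
      (N.factorial * (2 * ((exp 1 * Z) ^ K * exp (exp 1 * (L * (W + 1))))) ^ N))
    (hlow : 1 ≤ exp (d * (N * (L * W))) * D *
      (N.factorial * (Z ^ K * exp (L * W)) ^ N) ^ (d - 1))
    (hmain : (d + 1) * log (N + 1) + log 2 + K * (1 + log Z) +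
      exp 1 * (L * (W + 1)) + d * (L * W) + (d - 1) * (K * log Z + L * W) < (N - 1) / 2) :
    False := by
  have hN1 : (1 : ℝ) ≤ N := by exact_mod_cast hNN
  have hfac : log (N.factorial : ℝ) ≤ N * log (N + 1) := by
    rw [← log_pow]
    refine log_le_log (by positivity) ?_
    calc (N.factorial : ℝ) ≤ (N : ℝ) ^ N := by exact_mod_cast Nat.factorial_le_pow N
      _ ≤ _ := by gcongr; linarith
  have hlogup := log_le_log (by positivity) hup
  have hloglow := log_le_log one_pos hlow
  have hZ0 : 0 < Z := by linarith
  have hF : (0 : ℝ) < N.factorial := by positivity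
  rw [log_mul hdp.ne' (by positivity), log_pow, log_exp, log_mul (by positivity) (by positivity),
    log_pow, log_mul hF.ne' (by positivity), log_pow, log_mul two_ne_zero (by positivity),
    log_mul (by positivity) (exp_ne_zero _), log_exp, log_pow, log_mul (exp_ne_zero _) hZ0.ne',
    log_exp] at hlogup
  rw [log_one, log_mul (by positivity) (by positivity), log_mul (exp_ne_zero _) hdp.ne', log_exp,
    log_pow, log_mul hF.ne' (by positivity), log_pow, log_mul (by positivity) (exp_ne_zero _),
    log_exp, log_pow, Nat.cast_sub hd1] at hloglow
  have hsum : ((∑ m ∈ Finset.range N, m : ℕ) : ℝ) = N * ((N - 1) / 2) := by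
    have := congrArg ((↑) : ℕ → ℝ) (Finset.sum_range_id_mul_two N)
    rw [Nat.cast_mul, Nat.cast_mul, Nat.cast_sub hNN] at this
    push_cast at this ⊢
    linarith
  rw [hsum] at hlogup
  have hd1' : (0 : ℝ) ≤ d - 1 := by
    rw [sub_nonneg]; exact_mod_cast hd1
  push_cast at hloglow hlogup
  have h3 := mul_lt_mul_of_pos_left hmain (zero_lt_one.trans_le hN1)
  have h4 := mul_le_mul_of_nonneg_left hfac hd1'
  nlinarith

set_option maxHeartbeats 800000 in
theorem false_of_small_linear_form {ι : Type*} [Fintype ι] {S : Subring (ι → ℝ)} {o : ι}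
    (hS : HasNormGeOne S o) {h₁ h₂ : ℝ} {x y : ι → ℝ} (hx : HeightLE S h₁ x)
    (hy : HeightLE S h₂ y) (hxo : 0 < x o) (hyo : 0 < y o) (p q : ℤ) (hq : q ≠ 0) {K L R T : ℕ}
    (hK : 1 ≤ K) (hL : 1 ≤ L) (hR : 1 ≤ R) (hT : 1 ≤ T) (hKL : K * L ≤ R * T) (Z W Λ : ℝ)
    (hZ : Z = (2 * R : ℕ) * |(q : ℝ)| + (2 * T : ℕ) * |(p : ℝ)|)
    (hW : W = (2 * R : ℕ) * h₁ + (2 * T : ℕ) * h₂)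
    (hΛ : Λ = p * log (x o) + q * log (y o)) (hΛ0 : Λ ≠ 0)
    (hΛ1 : 2 * L * (2 * T : ℕ) * |Λ| * exp (K * L : ℕ) ≤ 1)
    (hΛ2 : 2 * (R + T) * |Λ| < exp (-(Fintype.card ι * (2 * W + 1))))
    (hmain : (Fintype.card ι + 1) * log ((K * L : ℕ) + 1) + log 2 + K * (1 + log Z) +
      exp 1 * (L * (W + 1)) + Fintype.card ι * (L * W) +
      (Fintype.card ι - 1) * (K * log Z + L * W) < ((K * L : ℕ) - 1) / 2) : False := by
  classical
  have : Nonempty ι := ⟨o⟩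
  have hh₁ := hx.nonneg
  have hh₂ := hy.nonneg
  have hR1 : (1 : ℝ) ≤ R := by exact_mod_cast hR
  have hT1 : (1 : ℝ) ≤ T := by exact_mod_cast hT
  have hq1 : 1 ≤ |(q : ℝ)| := by exact_mod_cast Int.one_le_abs hq
  set N := K * L with hN
  set l₁ := log (x o) with hl₁
  set l₂ := log (y o) with hl₂
  have hZ1 : 1 ≤ Z := by
    rw [hZ]
    push_cast
    have : 0 ≤ 2 * (T : ℝ) * |(p : ℝ)| := by positivity
    nlinarith
  have caseA : ∀ r s : ℤ, |r| < R → |s| < T → r * q = s * p → r = 0 ∧ s = 0 := by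
    intro r s hr hs hrs
    have hr' : |(r : ℝ)| ≤ R := by exact_mod_cast hr.le
    have hs' : |(s : ℝ)| ≤ T := by exact_mod_cast hs.le
    by_contra hne
    have hs0 : s ≠ 0 := by
      rintro rfl
      rw [zero_mul] at hrs
      exact hne ⟨(mul_eq_zero.1 hrs).resolve_right hq, rfl⟩
    have hv : (x ^ r * y ^ s) o = x o ^ r * y o ^ s := by simp
    have hrs' : (r : ℝ) * q = s * p := by exact_mod_cast hrs
    refine ((hx.zpow r).mul (hy.zpow s)).false_of_abs_log_small hS (by rw [hv]; positivity) ?_ hΛ0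
      hΛ2 (t := q) (c := s) hq hs0 (by linarith) ?_
    · rw [hW]
      push_cast
      nlinarith [mul_le_mul_of_nonneg_right hr' hh₁, mul_le_mul_of_nonneg_right hs' hh₂,
        mul_nonneg (zero_le_one.trans hR1) hh₁, mul_nonneg (zero_le_one.trans hT1) hh₂]
    · rw [hv, log_mul (by positivity) (by positivity), log_zpow, log_zpow, hΛ]
      linear_combination l₁ * hrs'
  have caseB : ∀ r s : ℤ, |r| < R → |s| < T → r * l₁ + s * l₂ = 0 → r = 0 ∧ s = 0 := by
    intro r s hr hs hrs
    have hr' : |(r : ℝ)| ≤ R := by exact_mod_cast hr.le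
    have hs' : |(s : ℝ)| ≤ T := by exact_mod_cast hs.le
    by_contra hne
    have ht : r * q - s * p ≠ 0 := fun h => hne (caseA r s hr hs (by linarith))
    by_cases hs0 : s = 0
    · have hr0 : r ≠ 0 := fun h => hne ⟨h, hs0⟩
      refine hy.false_of_abs_log_small hS hyo ?_ hΛ0 hΛ2 ht hr0 (by linarith) ?_
      · rw [hW]
        push_cast
        nlinarith [mul_le_mul_of_nonneg_right hT1 hh₂, mul_nonneg (zero_le_one.trans hR1) hh₁]
      · push_cast
        rw [hΛ]
        linear_combination -p * hrs
    · refine hx.false_of_abs_log_small hS hxo ?_ hΛ0 hΛ2 ht (neg_ne_zero.2 hs0)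
        (by push_cast; rw [abs_neg]; linarith) ?_
      · rw [hW]
        push_cast
        nlinarith [mul_le_mul_of_nonneg_right hR1 hh₁, mul_nonneg (zero_le_one.trans hT1) hh₂]
      · push_cast
        rw [hΛ]
        linear_combination q * hrs
  let u : ℕ × ℕ → ℝ := fun a => a.1 * q - a.2 * p
  let w : ℕ × ℕ → ℝ := fun a => a.1 * l₁ + a.2 * l₂
  have hgrid : ∀ a ∈ (Finset.range R ×ˢ Finset.range T : Finset (ℕ × ℕ)), a.1 < R ∧ a.2 < T :=
    fun a ha => by simpa using ha
  have hdiff : ∀ a ∈ (Finset.range R ×ˢ Finset.range T : Finset (ℕ × ℕ)),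
      ∀ b ∈ (Finset.range R ×ˢ Finset.range T : Finset (ℕ × ℕ)),
      |((a.1 : ℤ) - b.1)| < R ∧ |((a.2 : ℤ) - b.2)| < T := by
    intro a ha b hb
    have h1 := hgrid a ha
    have h2 := hgrid b hb
    constructor <;> rw [abs_lt] <;> constructor <;> omega
  have hfin : ∀ a b : ℕ × ℕ, (a.1 : ℤ) - b.1 = 0 ∧ (a.2 : ℤ) - b.2 = 0 → a = b := by
    rintro a b ⟨h1, h2⟩
    ext <;> omega
  let e : Fin N ≃ Fin K × Fin L := finProdFinEquiv.symm
  let k : Fin N → ℕ := fun i => (e i).1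
  let l : Fin N → ℕ := fun i => (e i).2
  have hk : ∀ i, k i < K := fun i => (e i).1.2
  have hl : ∀ i, l i < L := fun i => (e i).2.2
  have hkl : Function.Injective fun i => (k i, l i) := by
    intro i j hij
    apply e.injective
    simp only [Prod.mk.injEq, k, l] at hij
    exact Prod.ext (Fin.ext hij.1) (Fin.ext hij.2)
  obtain ⟨g, hg, hdet⟩ := exists_det_ne_zero_of_span_eq_top
    {v : Fin N → ℝ | ∃ a : ℕ × ℕ, (a.1 < 2 * R ∧ a.2 < 2 * T) ∧
      v = fun i => u a ^ k i * exp (l i * w a)} (by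
    intro φ hφ
    refine eq_zero_of_forall_grid (K := K) (L := L) (R := R) (T := T) k l hkl hk hl hK hL hKL u w
      ?_ ?_ ?_ ?_ φ (fun a h1 h2 => hφ _ ⟨a, ⟨h1, h2⟩, rfl⟩)
    · intro a b
      simp only [u, Prod.fst_add, Prod.snd_add, Nat.cast_add]
      ring
    · intro a b
      simp only [w, Prod.fst_add, Prod.snd_add, Nat.cast_add]
      ring
    · intro a ha b hb hab
      refine hfin a b (caseA _ _ (hdiff a (by exact_mod_cast ha) b (by exact_mod_cast hb)).1
        (hdiff a (by exact_mod_cast ha) b (by exact_mod_cast hb)).2 ?_)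
      simp only [u] at hab
      have : ((a.1 : ℝ) - b.1) * q = (a.2 - b.2) * p := by linear_combination hab
      exact_mod_cast this
    · intro a ha b hb hab
      refine hfin a b (caseB _ _ (hdiff a (by exact_mod_cast ha) b (by exact_mod_cast hb)).1
        (hdiff a (by exact_mod_cast ha) b (by exact_mod_cast hb)).2 ?_)
      simp only [w] at hab
      push_cast
      linear_combination hab)
  choose f hf hgf using hg
  let z : Fin N → ℤ := fun j => (f j).1 * q - (f j).2 * p
  have hz : ∀ j, |(z j : ℝ)| ≤ Z := by
    intro j
    simp only [z]
    push_cast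
    refine (abs_sub _ _).trans ?_
    rw [abs_mul, abs_mul, Nat.abs_cast, Nat.abs_cast, hZ]
    have h1 : ((f j).1 : ℝ) ≤ (2 * R : ℕ) := by exact_mod_cast (hf j).1.le
    have h2 : ((f j).2 : ℝ) ≤ (2 * T : ℕ) := by exact_mod_cast (hf j).2.le
    gcongr
  set A : Matrix (Fin N) (Fin N) ℝ :=
    Matrix.of fun i j => (z j : ℝ) ^ k i * (x o ^ (f j).1 * y o ^ (f j).2) ^ l i with hA
  have hexp : ∀ j, x o ^ (f j).1 * y o ^ (f j).2 = exp ((f j).1 * l₁ + (f j).2 * l₂) := by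
    intro j
    rw [exp_add, exp_nat_mul, exp_nat_mul, exp_log hxo, exp_log hyo]
  have hAg : A = (Matrix.of g).transpose := by
    ext i j
    simp only [hA, Matrix.of_apply, Matrix.transpose_apply, hgf, hexp, z, u, w]
    rw [← exp_nat_mul]
    push_cast
    rfl
  have hAdet : A.det ≠ 0 := by rwa [hAg, Matrix.det_transpose]
  have hup := interpolation_det_upper_bound (N := N) (K := K) (L := L) (R := 2 * R) (S := 2 * T)
    l₁ l₂ p q hq hL (by omega) Z W hZ (by
      rw [hW]
      have := hx.abs_log_le hxo
      have := hy.abs_log_le hyo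
      gcongr) (by rw [← hΛ]; exact hΛ1) f hf k l hk hl (Nat.le_mul_of_pos_right _ hL) A (by
      intro i j
      rw [hA, Matrix.of_apply, hexp, ← exp_nat_mul]
      simp only [z]
      push_cast
      rfl)
  have hlow := interpolation_det_lower_bound hS hx hy (N := N) (K := K) (L := L) (R := 2 * R)
    (T := 2 * T) z Z W hZ1 hz hW f hf k l hk hl hAdet
  rw [← hA] at hlow
  have hW0 : 0 ≤ W := by rw [hW]; positivity
  exact false_of_det_bounds (abs_pos.2 hAdet) (Nat.mul_pos hK hL) Fintype.card_pos hZ1 hup hlow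
    hmain

theorem Int.eq_zero_of_sq_eq_mul_sq {D x y : ℤ} (hD : ¬IsSquare D) (h : x ^ 2 = D * y ^ 2) :
    x = 0 ∧ y = 0 := by
  by_cases hy : y = 0
  · subst hy
    simpa using h
  · exfalso
    have h1 : y ^ 2 ∣ x ^ 2 := ⟨D, by rw [h, mul_comm]⟩
    obtain ⟨z, rfl⟩ := (Int.pow_dvd_pow_iff two_ne_zero).1 h1
    refine hD ⟨z, ?_⟩
    have h2 : y ^ 2 * (D - z * z) = 0 := by linear_combination -h
    rcases mul_eq_zero.1 h2 with h3 | h3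
    · exact absurd (pow_eq_zero_iff two_ne_zero |>.1 h3) hy
    · linarith

theorem biquadratic_norm_ne_zero {D E a b c d : ℤ} (hD : ¬IsSquare D) (hE : ¬IsSquare E)
    (hDE : ¬IsSquare (D * E))
    (h : (a ^ 2 + b ^ 2 * D - E * (c ^ 2 + d ^ 2 * D)) ^ 2 - D * (2 * (a * b - E * c * d)) ^ 2 = 0) :
    a = 0 ∧ b = 0 ∧ c = 0 ∧ d = 0 := by
  obtain ⟨h1, h2⟩ := Int.eq_zero_of_sq_eq_mul_sq hD (sub_eq_zero.1 h)
  have h3 : a * b = E * c * d := by linarith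
  have h4 : a ^ 2 + b ^ 2 * D = E * (c ^ 2 + d ^ 2 * D) := by linarith
  have h5 : (a * c - b * d * D) * (b * c - a * d) = 0 := by
    linear_combination (c ^ 2 + d ^ 2 * D) * h3 - c * d * h4
  have h6 : (a * c - b * d * D) ^ 2 + D * (b * c - a * d) ^ 2 = E * (c ^ 2 - d ^ 2 * D) ^ 2 := by
    linear_combination (c ^ 2 + d ^ 2 * D) * h4 - 4 * c * d * D * h3
  have h7 : c ^ 2 - d ^ 2 * D = 0 := by
    rcases mul_eq_zero.1 h5 with h0 | h0
    · refine (Int.eq_zero_of_sq_eq_mul_sq hDE (x := D * (b * c - a * d)) ?_).2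
      rw [h0] at h6
      linear_combination D * h6
    · refine (Int.eq_zero_of_sq_eq_mul_sq hE (x := a * c - b * d * D) ?_).2
      rw [h0] at h6
      linear_combination h6
  obtain ⟨hc, hd⟩ := Int.eq_zero_of_sq_eq_mul_sq hD (x := c) (y := d) (by linarith)
  subst hc hd
  obtain ⟨ha, hb⟩ := Int.eq_zero_of_sq_eq_mul_sq hD (x := a) (y := b) (by
    have h8 : a * b = 0 := by simpa using h3
    have h9 : a ^ 2 + b ^ 2 * D = 0 := by simpa using h4
    rcases mul_eq_zero.1 h8 with h0 | h0
    · subst h0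
      linarith
    · subst h0
      linarith)
  exact ⟨ha, hb, rfl, rfl⟩

/-- The sign attached to a Boolean. -/
def boolSign (e : Bool) : ℝ := if e then 1 else -1

theorem boolSign_sq (e : Bool) : boolSign e ^ 2 = 1 := by
  cases e <;> simp [boolSign]

/-- The ring `ℤ[√D, √E]`, embedded in `ℝ ^ 4` by the four choices of signs of the square roots. -/
def biquadraticSubring (D E : ℕ) : Subring (Bool × Bool → ℝ) where
  carrier := {v | ∃ a b c d : ℤ, ∀ i, v i = a + b * (boolSign i.1 * √D) + c * (boolSign i.2 * √E) +
    d * (boolSign i.1 * √D) * (boolSign i.2 * √E)}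
  mul_mem' := by
    rintro v w ⟨a, b, c, d, hv⟩ ⟨a', b', c', d', hw⟩
    refine ⟨a * a' + b * b' * D + c * c' * E + d * d' * D * E,
      a * b' + b * a' + (c * d' + d * c') * E, a * c' + c * a' + (b * d' + d * b') * D,
      a * d' + d * a' + b * c' + c * b', fun i => ?_⟩
    rw [Pi.mul_apply, hv, hw]
    have h1 : (boolSign i.1 * √(D : ℝ)) ^ 2 = D := by
      rw [mul_pow, boolSign_sq, sq_sqrt (Nat.cast_nonneg _), one_mul]
    have h2 : (boolSign i.2 * √(E : ℝ)) ^ 2 = E := by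
      rw [mul_pow, boolSign_sq, sq_sqrt (Nat.cast_nonneg _), one_mul]
    generalize boolSign i.1 * √(D : ℝ) = u at *
    generalize boolSign i.2 * √(E : ℝ) = w at *
    push_cast
    rw [← h1, ← h2]
    ring
  one_mem' := ⟨1, 0, 0, 0, fun i => by simp⟩
  add_mem' := by
    rintro v w ⟨a, b, c, d, hv⟩ ⟨a', b', c', d', hw⟩
    refine ⟨a + a', b + b', c + c', d + d', fun i => ?_⟩
    rw [Pi.add_apply, hv, hw]
    push_cast
    ring
  zero_mem' := ⟨0, 0, 0, 0, fun i => by simp⟩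
  neg_mem' := by
    rintro v ⟨a, b, c, d, hv⟩
    refine ⟨-a, -b, -c, -d, fun i => ?_⟩
    rw [Pi.neg_apply, hv]
    push_cast
    ring

theorem hasNormGeOne_biquadraticSubring {D E : ℕ} (hD : ¬IsSquare (D : ℤ)) (hE : ¬IsSquare (E : ℤ))
    (hDE : ¬IsSquare ((D : ℤ) * E)) :
    HasNormGeOne (biquadraticSubring D E) (true, true) := by
  rintro v ⟨a, b, c, d, hv⟩ hv0
  have hprod : ∏ i, |v i| = |(((a ^ 2 + b ^ 2 * D - E * (c ^ 2 + d ^ 2 * D)) ^ 2 -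
      D * (2 * (a * b - E * c * d)) ^ 2 : ℤ) : ℝ)| := by
    have h1 := sq_sqrt (Nat.cast_nonneg (α := ℝ) D)
    have h2 := sq_sqrt (Nat.cast_nonneg (α := ℝ) E)
    rw [← Finset.abs_prod, Fintype.prod_prod_type, Fintype.prod_bool, Fintype.prod_bool,
      Fintype.prod_bool]
    simp only [hv, boolSign]
    congr 1
    simp
    generalize √(D : ℝ) = u at *
    generalize √(E : ℝ) = w at *
    rw [← h1, ← h2]
    ring
  rw [hprod]
  have hne : ((a ^ 2 + b ^ 2 * D - E * (c ^ 2 + d ^ 2 * D)) ^ 2 -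
      D * (2 * (a * b - E * c * d)) ^ 2 : ℤ) ≠ 0 := by
    intro h
    obtain ⟨rfl, rfl, rfl, rfl⟩ := biquadratic_norm_ne_zero hD hE hDE h
    exact hv0 (by simp [hv])
  exact_mod_cast Int.one_le_abs hne

theorem exists_card_divisors_le_rpow {ε : ℝ} (hε : 0 < ε) :
    ∃ C : ℝ, 1 ≤ C ∧ ∀ n : ℕ, n ≠ 0 → (n.divisors.card : ℝ) ≤ C * (n : ℝ) ^ ε := by
  set M : ℝ := max 1 (1 / (ε * log 2)) with hM
  set P : ℕ := ⌈(2 : ℝ) ^ (1 / ε)⌉₊ with hP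
  have hM1 : 1 ≤ M := le_max_left _ _
  have hl2 : 0 < log 2 := log_pos one_lt_two
  refine ⟨M ^ P, one_le_pow₀ hM1, fun n hn => ?_⟩
  have key : ∀ p : ℕ, p.Prime → ∀ a : ℕ,
      ((a + 1 : ℕ) : ℝ) ≤ (if p < P then M else 1) * ((p : ℝ) ^ a) ^ ε := by
    intro p hp a
    have hp2 : (2 : ℝ) ≤ p := by exact_mod_cast hp.two_le
    have e1 : ((p : ℝ) ^ a) ^ ε = ((p : ℝ) ^ ε) ^ a := by
      rw [← rpow_natCast, ← rpow_mul (by positivity), mul_comm, rpow_mul (by positivity),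
        rpow_natCast]
    rw [e1]
    split_ifs with h
    · have h1 : 1 + a * (ε * log 2) ≤ ((p : ℝ) ^ ε) ^ a := by
        calc 1 + a * (ε * log 2) ≤ exp (a * (ε * log 2)) := by
              linarith [add_one_le_exp (a * (ε * log 2))]
          _ = ((2 : ℝ) ^ ε) ^ a := by
              rw [exp_nat_mul, rpow_def_of_pos two_pos, mul_comm ε]
          _ ≤ _ := by gcongr
      have h2 : (a : ℝ) ≤ M * (a * (ε * log 2)) := by
        calc (a : ℝ) = 1 / (ε * log 2) * (a * (ε * log 2)) := by field_simp
          _ ≤ _ := by gcongr; exact le_max_right _ _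
      have h3 := mul_le_mul_of_nonneg_left h1 (zero_le_one.trans hM1)
      push_cast
      linarith
    · have h1 : (2 : ℝ) ≤ (p : ℝ) ^ ε := by
        calc (2 : ℝ) = ((2 : ℝ) ^ (1 / ε)) ^ ε := by
              rw [← rpow_mul two_pos.le, one_div_mul_cancel hε.ne', rpow_one]
          _ ≤ _ := by
              gcongr
              exact (Nat.le_ceil _).trans (by exact_mod_cast not_lt.1 h)
      rw [one_mul]
      calc ((a + 1 : ℕ) : ℝ) ≤ (2 : ℝ) ^ a := by exact_mod_cast Nat.lt_two_pow_self
        _ ≤ _ := by gcongr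
  have hfac : (n : ℝ) ^ ε = ∏ p ∈ n.primeFactors, ((p : ℝ) ^ n.factorization p) ^ ε := by
    rw [finsetProd_rpow _ _ fun _ _ => by positivity]
    congr 1
    exact_mod_cast (Nat.prod_factorization_pow_eq_self hn).symm
  rw [Nat.card_divisors hn, hfac]
  push_cast
  calc ∏ p ∈ n.primeFactors, ((n.factorization p : ℝ) + 1)
      ≤ ∏ p ∈ n.primeFactors, (if p < P then M else 1) * ((p : ℝ) ^ n.factorization p) ^ ε := by
        refine Finset.prod_le_prod (fun _ _ => by positivity) fun p hp => ?_
        exact_mod_cast key p (Nat.prime_of_mem_primeFactors hp) _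
    _ = M ^ (n.primeFactors.filter (· < P)).card *
          ∏ p ∈ n.primeFactors, ((p : ℝ) ^ n.factorization p) ^ ε := by
        rw [Finset.prod_mul_distrib, Finset.prod_ite, Finset.prod_const, Finset.prod_const_one,
          mul_one]
    _ ≤ _ := by
        refine mul_le_mul_of_nonneg_right (pow_le_pow_right₀ hM1 ?_) (by positivity)
        refine (Finset.card_le_card (t := Finset.range P) fun p hp => ?_).trans_eq
          (Finset.card_range P)
        exact Finset.mem_range.2 (Finset.mem_filter.1 hp).2

theorem Int.sq_sub_mul_sq_ne_zero {D : ℕ} (hD : ¬IsSquare (D : ℤ)) {x y : ℤ} (hy : y ≠ 0) :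
    x ^ 2 - D * y ^ 2 ≠ 0 := fun h =>
  hy (Int.eq_zero_of_sq_eq_mul_sq hD (sub_eq_zero.1 h)).2

theorem one_lt_of_not_isSquare {D : ℕ} (hD : ¬IsSquare (D : ℤ)) : 1 < D := by
  by_contra! h
  interval_cases D <;> simp at hD

theorem exists_small_norm {D : ℕ} (hD : ¬IsSquare (D : ℤ)) {Q : ℕ} (hQ : 1 ≤ Q) :
    ∃ x y : ℤ, IsCoprime x y ∧ y ≠ 0 ∧ |((x ^ 2 - D * y ^ 2 : ℤ) : ℝ)| ≤ 2 * √D ∧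
      0 < x + y * √(D : ℝ) ∧ x + y * √(D : ℝ) ≤ 2 * Q * √D + 1 ∧
      |x - y * √(D : ℝ)| ≤ 1 / (Q + 1) := by
  obtain ⟨q, hq, hqQ⟩ := Real.exists_rat_abs_sub_le_and_den_le (√(D : ℝ)) (Nat.pos_of_ne_zero (by omega : Q ≠ 0))
  have hd : (0 : ℝ) < q.den := by exact_mod_cast q.den_pos
  have hs : 1 < √(D : ℝ) := by
    rw [lt_sqrt zero_le_one, one_pow]
    exact_mod_cast one_lt_of_not_isSquare hD
  have hs2 := sq_sqrt (Nat.cast_nonneg (α := ℝ) D)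
  have hQ1 : (1 : ℝ) ≤ Q := by exact_mod_cast hQ
  have hqQ' : (q.den : ℝ) ≤ Q := by exact_mod_cast hqQ
  have hd1 : (1 : ℝ) ≤ q.den := by exact_mod_cast q.den_pos
  have h1 : |(q.num : ℝ) - q.den * √(D : ℝ)| ≤ 1 / (Q + 1) := by
    have e1 : (q : ℝ) = q.num / q.den := Rat.cast_def q
    have e2 : (q.num : ℝ) - q.den * √(D : ℝ) = -(q.den * (√D - q)) := by
      rw [e1]
      field_simp
      ring
    rw [e2, abs_neg, abs_mul, Nat.abs_cast]
    calc _ ≤ (q.den : ℝ) * (1 / ((Q + 1) * q.den)) := by gcongr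
      _ = _ := by field_simp
  have h2 : 1 / ((Q : ℝ) + 1) ≤ 1 / 2 := by gcongr; linarith
  have h3 := abs_le.1 h1
  have h4 : (1 : ℝ) ≤ q.den * √D := by nlinarith
  have h5 : (q.num : ℝ) + q.den * √D ≤ 2 * Q * √D + 1 / (Q + 1) := by nlinarith
  have h6 : (0 : ℝ) < q.num + q.den * √D := by linarith
  refine ⟨q.num, q.den, Rat.isCoprime_num_den q, by exact_mod_cast q.den_pos.ne', ?_, ?_, ?_, ?_⟩
  · have e : ((q.num ^ 2 - D * (q.den : ℤ) ^ 2 : ℤ) : ℝ) =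
        (q.num + q.den * √D) * (q.num - q.den * √D) := by
      push_cast
      nth_rewrite 1 [← hs2]
      ring
    rw [e, abs_mul, abs_of_pos h6]
    calc _ ≤ (2 * Q * √D + 1 / (Q + 1)) * (1 / (Q + 1)) := by gcongr
      _ ≤ (2 * (Q + 1) * √D) * (1 / (Q + 1)) := by
        refine mul_le_mul_of_nonneg_right ?_ (by positivity)
        nlinarith
      _ = _ := by field_simp
  · exact_mod_cast h6
  · push_cast
    linarith
  · exact_mod_cast h1

theorem exists_residue_of_norm {D : ℕ} (hD : ¬IsSquare (D : ℤ)) {x y : ℤ} (hxy : IsCoprime x y)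
    (hy : y ≠ 0) (hb : |((x ^ 2 - D * y ^ 2 : ℤ) : ℝ)| ≤ 2 * √D) :
    ∃ c ∈ (Finset.range (Nat.sqrt (4 * D) + 1)).sigma fun r => ((D : ℤ) - r ^ 2).natAbs.divisors,
      c.2 = (x ^ 2 - D * y ^ 2).natAbs ∧ x ≡ y * c.1 [ZMOD x ^ 2 - D * y ^ 2] ∧
        (c.1 : ℤ) ^ 2 ≡ D [ZMOD x ^ 2 - D * y ^ 2] := by
  set m : ℤ := x ^ 2 - D * y ^ 2 with hm
  have hm0 : m ≠ 0 := Int.sq_sub_mul_sq_ne_zero hD hy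
  have hym : IsCoprime y m := by
    rw [hm]
    have h : IsCoprime y (x ^ 2) := hxy.symm.pow_right
    have e : x ^ 2 - (D : ℤ) * y ^ 2 = x ^ 2 + y * (-(D * y)) := by ring
    rw [e]
    exact h.add_mul_left_right _
  obtain ⟨a, b, hab⟩ := hym
  set r : ℤ := (a * x) % m with hr
  have hr0 : 0 ≤ r := Int.emod_nonneg _ hm0
  have hrm : r < |m| := Int.emod_lt_abs _ hm0
  have hmod : r ≡ a * x [ZMOD m] := Int.mod_modEq _ _
  have h1 : x ≡ y * r [ZMOD m] := by
    refine Int.ModEq.symm ((hmod.mul_left y).trans ?_)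
    refine (Int.modEq_iff_dvd.2 ⟨b * x, ?_⟩)
    linear_combination -x * hab
  have h2 : r ^ 2 ≡ D [ZMOD m] := by
    refine (hmod.pow 2).trans (Int.modEq_iff_dvd.2 ?_)
    have : (D : ℤ) - (a * x) ^ 2 = m * (b * D * (a * y + 1) - a ^ 2) := by
      rw [hm] at hab ⊢
      linear_combination (-(D : ℤ) * (a * y + 1)) * hab
    exact ⟨_, this⟩
  have hrn : (r.toNat : ℤ) = r := Int.toNat_of_nonneg hr0
  refine ⟨⟨r.toNat, m.natAbs⟩, ?_, rfl, by rwa [hrn], by rwa [hrn]⟩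
  rw [Finset.mem_sigma, Finset.mem_range, Nat.mem_divisors]
  refine ⟨Nat.lt_succ_of_le (Nat.le_sqrt'.2 ?_), ?_, ?_⟩
  · have h3 : (r : ℝ) ≤ 2 * √D := by
      refine le_trans ?_ hb
      exact_mod_cast hrm.le
    have h4 : (r : ℝ) ^ 2 ≤ 4 * D := by
      have : (0 : ℝ) ≤ r := by exact_mod_cast hr0
      calc (r : ℝ) ^ 2 ≤ (2 * √D) ^ 2 := by gcongr
        _ = _ := by rw [mul_pow, sq_sqrt (Nat.cast_nonneg _)]; norm_num
    zify
    rw [hrn]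
    exact_mod_cast h4
  · rw [Int.natAbs_dvd_natAbs, hrn]
    exact h2.dvd
  · rw [hrn, Int.natAbs_ne_zero]
    intro h
    exact hD ⟨r, by linarith⟩

theorem exists_unit_of_residue_eq {D : ℕ} {x y x' y' r : ℤ}
    (hm0 : x ^ 2 - D * y ^ 2 ≠ 0)
    (hmm : (x ^ 2 - D * y ^ 2).natAbs = (x' ^ 2 - D * y' ^ 2).natAbs)
    (h1 : x ≡ y * r [ZMOD x ^ 2 - D * y ^ 2]) (h1' : x' ≡ y' * r [ZMOD x' ^ 2 - D * y' ^ 2])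
    (h2 : r ^ 2 ≡ D [ZMOD x ^ 2 - D * y ^ 2]) :
    ∃ a b : ℤ, |a ^ 2 - D * b ^ 2| = 1 ∧
      (x ^ 2 - D * y ^ 2) * a = x * x' - D * y * y' ∧
      (x ^ 2 - D * y ^ 2) * b = x * y' - y * x' := by
  set m := x ^ 2 - D * y ^ 2 with hm
  set m' := x' ^ 2 - D * y' ^ 2 with hm'
  have hdvd : m ∣ m' := Int.natAbs_dvd_natAbs.1 hmm.dvd
  have h1'' : x' ≡ y' * r [ZMOD m] := h1'.of_dvd hdvd
  have ha : x * x' ≡ D * y * y' [ZMOD m] := by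
    refine (h1.mul h1'').trans ?_
    have := h2.mul_left (y * y')
    convert this using 1 <;> ring
  have hb : x * y' ≡ y * x' [ZMOD m] := by
    refine (h1.mul_right y').trans ?_
    have := (h1''.symm).mul_left y
    convert this using 1
    ring
  obtain ⟨a, ha⟩ := ha.symm.dvd
  obtain ⟨b, hb⟩ := hb.symm.dvd
  refine ⟨a, b, ?_, ha.symm, hb.symm⟩
  have h3 : m ^ 2 * (a ^ 2 - D * b ^ 2) = m * m' := by
    calc m ^ 2 * (a ^ 2 - D * b ^ 2) = (m * a) ^ 2 - D * (m * b) ^ 2 := by ring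
      _ = m * m' := by rw [← ha, ← hb, hm, hm']; ring
  have h4 : m * (a ^ 2 - D * b ^ 2) = m' := mul_left_cancel₀ hm0 (by linear_combination h3)
  have h5 : |m| = |m'| := by rw [Int.abs_eq_natAbs, Int.abs_eq_natAbs, hmm]
  rw [← h4, abs_mul] at h5
  have hm1 : |m| ≠ 0 := abs_ne_zero.2 hm0
  exact (mul_left_cancel₀ hm1 (by rw [mul_one]; exact h5)).symm

theorem exists_pell_unit_le_pow {D : ℕ} (hD : ¬IsSquare (D : ℤ)) :
    ∃ x y : ℤ, |x ^ 2 - D * y ^ 2| = 1 ∧ 1 < x + y * √(D : ℝ) ∧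
      x + y * √(D : ℝ) ≤ (3 * D : ℝ) ^ (∑ r ∈ Finset.range (Nat.sqrt (4 * D) + 1),
        ((D : ℤ) - r ^ 2).natAbs.divisors.card + 1) := by
  classical
  have hD1 : (2 : ℝ) ≤ D := by exact_mod_cast one_lt_of_not_isSquare hD
  have hDpos : 1 ≤ D := (one_lt_of_not_isSquare hD).le
  set s := √(D : ℝ) with hs
  have hs2 : s ^ 2 = D := sq_sqrt (Nat.cast_nonneg _)
  have hs0 : 0 ≤ s := sqrt_nonneg _
  have hs1 : 1 ≤ s := by nlinarith
  set C := (Finset.range (Nat.sqrt (4 * D) + 1)).sigma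
    fun r => ((D : ℤ) - r ^ 2).natAbs.divisors with hC
  have hCc : ∑ r ∈ Finset.range (Nat.sqrt (4 * D) + 1),
      ((D : ℤ) - r ^ 2).natAbs.divisors.card = C.card := by rw [hC, Finset.card_sigma]
  rw [hCc]
  choose x y hxy hy hb hpos hle hsm using fun j : ℕ =>
    exists_small_norm hD (Q := (3 * D) ^ j) (Nat.one_le_pow _ _ (by omega))
  choose c hcC hc2 hc1 hcD using fun j => exists_residue_of_norm hD (hxy j) (hy j) (hb j)
  replace hpos : ∀ j, 0 < x j + y j * s := hpos
  obtain ⟨i, hi, j, hj, hij, hcij⟩ := Finset.exists_ne_map_eq_of_card_lt_of_maps_to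
    (s := Finset.range (C.card + 1)) (t := C) (by simp) (f := c) (fun j _ => hcC j)
  wlog hlt : i < j generalizing i j
  · exact this j hj i hi hij.symm hcij.symm (by omega)
  have hn : ∀ j, (((x j) ^ 2 - D * (y j) ^ 2 : ℤ) : ℝ) = (x j + y j * s) * (x j - y j * s) := by
    intro j
    push_cast
    rw [← hs2]
    ring
  have hn1 : ∀ j, 1 ≤ (x j + y j * s) * |x j - y j * s| := by
    intro j
    have := Int.one_le_abs (Int.sq_sub_mul_sq_ne_zero hD (hy j) (x := x j))
    have h2 : (1 : ℝ) ≤ |(((x j) ^ 2 - D * (y j) ^ 2 : ℤ) : ℝ)| := by exact_mod_cast this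
    rwa [hn, abs_mul, abs_of_pos (hpos j)] at h2
  have hdec : |x j - y j * s| < |x i - y i * s| := by
    by_contra! hcon
    have h1 := (hn1 i).trans (mul_le_mul (hle i) (hcon.trans (hsm j)) (abs_nonneg _)
      (by positivity))
    rw [mul_one_div, one_le_div (by positivity)] at h1
    have h2 : ((3 * D : ℕ) : ℝ) ^ i * (3 * D) ≤ (3 * D : ℕ) ^ j := by
      have : (3 * D) ^ i * (3 * D) ≤ (3 * D) ^ j := by
        rw [← pow_succ]
        exact Nat.pow_le_pow_right (by omega) hlt
      exact_mod_cast this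
    push_cast at h1 h2
    have h3 : (0 : ℝ) < (3 * D) ^ i := by positivity
    have h4 : 2 * s < 3 * D := by nlinarith
    nlinarith
  have hceq : (x i ^ 2 - D * y i ^ 2).natAbs = (x j ^ 2 - D * y j ^ 2).natAbs := by
    rw [← hc2, ← hc2, hcij]
  obtain ⟨a, b, hab, ha, hb'⟩ := exists_unit_of_residue_eq (r := (c i).1)
    (Int.sq_sub_mul_sq_ne_zero hD (hy i)) hceq (hc1 i) (by rw [hcij]; exact hc1 j) (hcD i)
  set m : ℤ := x i ^ 2 - D * y i ^ 2 with hm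
  have hm1 : (1 : ℝ) ≤ |(m : ℝ)| := by
    exact_mod_cast Int.one_le_abs (Int.sq_sub_mul_sq_ne_zero hD (hy i) (x := x i))
  have haR : (m : ℝ) * a = x i * x j - D * y i * y j := by exact_mod_cast ha
  have hbR : (m : ℝ) * b = x i * y j - y i * x j := by exact_mod_cast hb'
  have hval : (m : ℝ) * (a + b * s) = (x i - y i * s) * (x j + y j * s) := by
    rw [mul_add, haR, ← mul_assoc, hbR, ← hs2]
    ring
  have habs : |(m : ℝ)| * |a + b * s| = |x i - y i * s| * (x j + y j * s) := by
    rw [← abs_mul, hval, abs_mul, abs_of_pos (hpos j)]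
  have hmj : |(m : ℝ)| = (x j + y j * s) * |x j - y j * s| := by
    have : |m| = |x j ^ 2 - D * y j ^ 2| := by
      rw [Int.abs_eq_natAbs, Int.abs_eq_natAbs, hceq]
    calc |(m : ℝ)| = |((x j ^ 2 - D * y j ^ 2 : ℤ) : ℝ)| := by exact_mod_cast this
      _ = _ := by rw [hn, abs_mul, abs_of_pos (hpos j)]
  have hgt : 1 < |a + b * s| := by
    by_contra! hcon
    have h1 : |(m : ℝ)| * |a + b * s| ≤ |(m : ℝ)| := mul_le_of_le_one_right (abs_nonneg _) hcon
    rw [habs, hmj, mul_comm] at h1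
    exact absurd (le_of_mul_le_mul_left h1 (hpos j)) (not_le.2 hdec)
  have hle' : |a + b * s| ≤ (3 * D : ℝ) ^ (C.card + 1) := by
    have h1 : |a + b * s| ≤ |x i - y i * s| * (x j + y j * s) := by
      rw [← habs]
      exact le_mul_of_one_le_left (abs_nonneg _) hm1
    have h2 : |x i - y i * s| ≤ 1 := by
      refine (hsm i).trans ?_
      rw [div_le_one (by positivity)]
      have : (0 : ℝ) ≤ ((3 * D) ^ i : ℕ) := by positivity
      linarith
    have hj' : j ≤ C.card := by
      have := Finset.mem_range.1 hj
      omega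
    have h3 : ((3 * D : ℝ)) ^ j ≤ (3 * D) ^ C.card := pow_le_pow_right₀ (by linarith) hj'
    have h4 : (1 : ℝ) ≤ (3 * D) ^ C.card := one_le_pow₀ (by linarith)
    have h5 := hle j
    push_cast at h5
    have h6 : 2 * s + 1 ≤ 3 * D := by nlinarith
    calc |a + b * s| ≤ 1 * (x j + y j * s) :=
          h1.trans (mul_le_mul_of_nonneg_right h2 (hpos j).le)
      _ ≤ 2 * (3 * D) ^ C.card * s + 1 := by
          rw [one_mul]
          refine h5.trans ?_
          gcongr
      _ ≤ (3 * D) ^ C.card * (3 * D) := by nlinarith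
      _ = _ := (pow_succ _ _).symm
  rcases le_total 0 (a + b * s) with h0 | h0
  · rw [abs_of_nonneg h0] at hgt hle'
    exact ⟨a, b, hab, hgt, hle'⟩
  · rw [abs_of_nonpos h0] at hgt hle'
    refine ⟨-a, -b, by simpa using hab, ?_, ?_⟩
    · push_cast
      linarith
    · push_cast
      linarith

theorem exists_pell_unit_log_le {ε : ℝ} (hε : 0 < ε) :
    ∃ C : ℝ, ∀ D : ℕ, ¬IsSquare (D : ℤ) → ∃ x y : ℤ, |x ^ 2 - D * y ^ 2| = 1 ∧
      1 < x + y * √(D : ℝ) ∧ log (x + y * √(D : ℝ)) ≤ C * (D : ℝ) ^ (1 / 2 + 2 * ε) := by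
  obtain ⟨C, hC1, hC⟩ := exists_card_divisors_le_rpow hε
  refine ⟨4 * C * 4 ^ (2 * ε) / ε, fun D hD => ?_⟩
  obtain ⟨x, y, hn, h1, hle⟩ := exists_pell_unit_le_pow hD
  refine ⟨x, y, hn, h1, ?_⟩
  have hD1 : (2 : ℝ) ≤ D := by exact_mod_cast one_lt_of_not_isSquare hD
  have hD0 : (0 : ℝ) < D := by linarith
  have hs2 : √(D : ℝ) ^ 2 = D := sq_sqrt hD0.le
  have hs0 : 0 ≤ √(D : ℝ) := sqrt_nonneg _
  have hs1 : 1 ≤ √(D : ℝ) := by nlinarith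
  have hlog := log_le_log (by linarith) hle
  rw [log_pow] at hlog
  have hr : ((Nat.sqrt (4 * D) : ℕ) : ℝ) ≤ 2 * √D := by
    rw [← abs_of_nonneg (by positivity : 0 ≤ 2 * √(D : ℝ)), ← Real.sqrt_sq_eq_abs]
    refine Real.le_sqrt_of_sq_le ?_
    rw [mul_pow, hs2]
    have := Nat.sqrt_le' (4 * D)
    have h2 : ((Nat.sqrt (4 * D) : ℕ) : ℝ) ^ 2 ≤ 4 * D := by exact_mod_cast this
    linarith
  have hsum : ((∑ r ∈ Finset.range (Nat.sqrt (4 * D) + 1),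
      ((D : ℤ) - r ^ 2).natAbs.divisors.card : ℕ) : ℝ) ≤
      (Nat.sqrt (4 * D) + 1) * (C * (4 * D : ℝ) ^ ε) := by
    have hterm : ∀ r ∈ Finset.range (Nat.sqrt (4 * D) + 1),
        (((D : ℤ) - r ^ 2).natAbs.divisors.card : ℝ) ≤ C * (4 * D : ℝ) ^ ε := by
      intro r hr
      have h0 : ((D : ℤ) - r ^ 2).natAbs ≠ 0 := by
        rw [Int.natAbs_ne_zero]
        intro h
        exact hD ⟨r, by linarith⟩
      refine (hC _ h0).trans ?_
      have h2 : r ^ 2 ≤ 4 * D := Nat.le_sqrt'.1 (Nat.lt_succ_iff.1 (Finset.mem_range.1 hr))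
      have h3 : ((D : ℤ) - r ^ 2).natAbs ≤ 4 * D := by
        zify
        rw [abs_le]
        have : (r : ℤ) ^ 2 ≤ 4 * D := by exact_mod_cast h2
        constructor <;> nlinarith
      gcongr
      exact_mod_cast h3
    push_cast
    refine (Finset.sum_le_sum hterm).trans_eq ?_
    simp
  have hpow1 : 1 ≤ (4 * D : ℝ) ^ ε := one_le_rpow (by linarith) hε.le
  have hlog3 : log (3 * D) ≤ (4 * D : ℝ) ^ ε / ε :=
    (log_le_log (by linarith) (by linarith)).trans (log_le_rpow_div (by linarith) hε)
  have hT : ((∑ r ∈ Finset.range (Nat.sqrt (4 * D) + 1),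
      ((D : ℤ) - r ^ 2).natAbs.divisors.card + 1 : ℕ) : ℝ) ≤ 4 * √D * (C * (4 * D : ℝ) ^ ε) := by
    have h2 : 1 ≤ C * (4 * D : ℝ) ^ ε := one_le_mul_of_one_le_of_one_le hC1 hpow1
    have h3 : (Nat.sqrt (4 * D) + 1 : ℝ) ≤ 3 * √D := by linarith
    have h4 := mul_le_mul_of_nonneg_right h3 (zero_le_one.trans h2)
    have h5 := one_le_mul_of_one_le_of_one_le hs1 h2
    rw [Nat.cast_add, Nat.cast_one]
    linarith
  refine hlog.trans ((mul_le_mul hT hlog3 (log_nonneg (by linarith)) (by positivity)).trans_eq ?_)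
  rw [rpow_add hD0, ← sqrt_eq_rpow, two_mul, rpow_add hD0, rpow_add (by norm_num),
    mul_rpow (by norm_num) hD0.le]
  ring

section Lattice

open Matrix

theorem exists_reduced_pair {n : Type*} [Fintype n] (w u₀ : n → ℤ)
    (hG : 0 < (w ⬝ᵥ w) * (u₀ ⬝ᵥ u₀) - (w ⬝ᵥ u₀) ^ 2) :
    ∃ (u v : n → ℤ) (p q : ℤ), w = p • u + q • v ∧ 0 < u ⬝ᵥ u ∧ 0 < v ⬝ᵥ v ∧
      4 * (u ⬝ᵥ v) ^ 2 ≤ (u ⬝ᵥ u) * (v ⬝ᵥ v) ∧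
      (u ⬝ᵥ u) * (v ⬝ᵥ v) - (u ⬝ᵥ v) ^ 2 = (w ⬝ᵥ w) * (u₀ ⬝ᵥ u₀) - (w ⬝ᵥ u₀) ^ 2 := by
  set G := (w ⬝ᵥ w) * (u₀ ⬝ᵥ u₀) - (w ⬝ᵥ u₀) ^ 2 with hGdef
  have hnn : ∀ u : n → ℤ, 0 ≤ u ⬝ᵥ u := fun u => Finset.sum_nonneg fun i _ => mul_self_nonneg _
  let A : Set ((n → ℤ) × (n → ℤ)) := {z | (∃ p q : ℤ, w = p • z.1 + q • z.2) ∧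
    (z.1 ⬝ᵥ z.1) * (z.2 ⬝ᵥ z.2) - (z.1 ⬝ᵥ z.2) ^ 2 = G}
  have hA : A.Nonempty := ⟨(w, u₀), ⟨1, 0, by simp⟩, rfl⟩
  let f : (n → ℤ) × (n → ℤ) → ℕ := fun z => (z.1 ⬝ᵥ z.1 + z.2 ⬝ᵥ z.2).toNat
  obtain ⟨⟨u, v⟩, ⟨⟨p, q, hpq⟩, hg⟩, hmin⟩ := exists_minimalFor_of_wellFoundedLT (· ∈ A) f hA
  simp only at hpq hg
  have hmin' : ∀ u' v', (u', v') ∈ A → u ⬝ᵥ u + v ⬝ᵥ v ≤ u' ⬝ᵥ u' + v' ⬝ᵥ v' := by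
    intro u' v' h
    by_contra! hcon
    have h1 : f (u', v') ≤ f (u, v) := Int.toNat_le_toNat hcon.le
    have h2 := hmin h h1
    simp only [f] at h2
    have := hnn u
    have := hnn v
    have := hnn u'
    have := hnn v'
    omega
  have hv : ∀ c : ℤ, (u, v + c • u) ∈ A := by
    intro c
    refine ⟨⟨p - q * c, q, ?_⟩, ?_⟩
    · rw [hpq]
      ext i
      simp
      ring
    · rw [← hg]
      simp only [dotProduct_add, add_dotProduct, dotProduct_smul, smul_dotProduct, smul_eq_mul,
        dotProduct_comm v u]
      ring
  have hu : ∀ c : ℤ, (u + c • v, v) ∈ A := by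
    intro c
    refine ⟨⟨p, q - p * c, ?_⟩, ?_⟩
    · rw [hpq]
      ext i
      simp
      ring
    · rw [← hg]
      simp only [dotProduct_add, add_dotProduct, dotProduct_smul, smul_dotProduct, smul_eq_mul,
        dotProduct_comm v u]
      ring
  have h1 := hmin' _ _ (hv 1)
  have h2 := hmin' _ _ (hv (-1))
  have h3 := hmin' _ _ (hu 1)
  have h4 := hmin' _ _ (hu (-1))
  simp only [dotProduct_add, add_dotProduct, dotProduct_smul, smul_dotProduct, smul_eq_mul,
        dotProduct_comm v u] at h1 h2 h3 h4
  have hu0 := hnn u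
  have hv0 := hnn v
  refine ⟨u, v, p, q, hpq, ?_, ?_, ?_, hg⟩
  · rcases hu0.eq_or_lt with h | h
    · rw [← h] at hg
      nlinarith [sq_nonneg (u ⬝ᵥ v)]
    · exact h
  · rcases hv0.eq_or_lt with h | h
    · rw [← h] at hg
      nlinarith [sq_nonneg (u ⬝ᵥ v)]
    · exact h
  · have h5 : |2 * (u ⬝ᵥ v)| ≤ u ⬝ᵥ u := abs_le.2 ⟨by linarith, by linarith⟩
    have h6 : |2 * (u ⬝ᵥ v)| ≤ v ⬝ᵥ v := abs_le.2 ⟨by linarith, by linarith⟩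
    calc 4 * (u ⬝ᵥ v) ^ 2 = |2 * (u ⬝ᵥ v)| * |2 * (u ⬝ᵥ v)| := by rw [abs_mul_abs_self]; ring
      _ ≤ _ := mul_le_mul h5 h6 (abs_nonneg _) hu0

theorem exists_small_wedge (a b : ℤ) {B : ℕ} (hB : 1 ≤ B) (ha : |a| ≤ B) (hb : |b| ≤ B) :
    ∃ x y : ℤ, 0 < x ^ 2 + y ^ 2 + (a * y - b * x) ^ 2 ∧
      x ^ 2 + y ^ 2 + (a * y - b * x) ^ 2 ≤ 9 * B := by
  wlog hab : |b| ≤ |a| generalizing a b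
  · obtain ⟨x, y, h1, h2⟩ := this b a hb ha (by omega)
    exact ⟨y, x, by linarith, by linarith⟩
  by_cases ha0 : a = 0
  · subst ha0
    have hb0 : b = 0 := by simpa using hab
    subst hb0
    exact ⟨1, 0, by norm_num, by norm_num; omega⟩
  have hQ : 0 < Nat.sqrt B := Nat.sqrt_pos.2 hB
  obtain ⟨j, k, hk0, hkQ, hjk⟩ := Real.exists_int_int_abs_mul_sub_le ((b : ℝ) / a) hQ
  have hQ1 : (1 : ℝ) ≤ Nat.sqrt B := by exact_mod_cast hQ
  have hQB : ((Nat.sqrt B : ℕ) : ℝ) ^ 2 ≤ B := by exact_mod_cast Nat.sqrt_le' B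
  have hBQ : (B : ℝ) ≤ (Nat.sqrt B + 1) ^ 2 := by exact_mod_cast (Nat.lt_succ_sqrt' B).le
  have haR : (a : ℝ) ≠ 0 := by exact_mod_cast ha0
  have ha' : |(a : ℝ)| ≤ B := by exact_mod_cast ha
  have hab' : |(b : ℝ)| ≤ |(a : ℝ)| := by exact_mod_cast hab
  have hk0' : (0 : ℝ) < k := by exact_mod_cast hk0
  have hkQ' : (k : ℝ) ≤ Nat.sqrt B := by exact_mod_cast hkQ
  refine ⟨k, j, by positivity, ?_⟩
  have h1 : |(a * j - b * k : ℝ)| ≤ Nat.sqrt B + 1 := by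
    have e : (a * j - b * k : ℝ) = -(a * (k * (b / a) - j)) := by
      field_simp
      ring
    rw [e, abs_neg, abs_mul]
    calc _ ≤ (B : ℝ) * (1 / (Nat.sqrt B + 1)) := by gcongr
      _ ≤ (Nat.sqrt B + 1) ^ 2 * (1 / (Nat.sqrt B + 1)) := by gcongr
      _ = _ := by field_simp
  have h2 : |(j : ℝ)| ≤ Nat.sqrt B + 1 := by
    have e : (j : ℝ) = k * (b / a) - (k * (b / a) - j) := by ring
    have h3 : |(b : ℝ) / a| ≤ 1 := by
      rw [abs_div]
      exact div_le_one_of_le₀ hab' (abs_nonneg _)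
    have h4 : 1 / ((Nat.sqrt B : ℝ) + 1) ≤ 1 := by
      rw [div_le_one (by positivity)]
      linarith
    rw [e]
    refine (abs_sub _ _).trans ?_
    rw [abs_mul, abs_of_pos hk0']
    nlinarith [abs_nonneg ((b : ℝ) / a)]
  have h5 : (j : ℝ) ^ 2 ≤ 4 * B := by
    rw [← sq_abs]
    nlinarith [abs_nonneg (j : ℝ)]
  have h6 : (a * j - b * k : ℝ) ^ 2 ≤ 4 * B := by
    rw [← sq_abs]
    nlinarith [abs_nonneg (a * j - b * k : ℝ)]
  have h7 : (k : ℝ) ^ 2 ≤ B := by nlinarith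
  have h8 : (k : ℝ) ^ 2 + j ^ 2 + (a * j - b * k) ^ 2 ≤ 9 * B := by linarith
  exact_mod_cast h8

theorem abs_coeff_mul_le {n : Type*} [Fintype n] {w u v : n → ℤ} {p q : ℤ}
    (h : w = p • u + q • v) (hG : 1 ≤ (u ⬝ᵥ u) * (v ⬝ᵥ v) - (u ⬝ᵥ v) ^ 2) :
    |p| ≤ |w ⬝ᵥ u| * (v ⬝ᵥ v) + |w ⬝ᵥ v| * |u ⬝ᵥ v| := by
  have h1 : p * ((u ⬝ᵥ u) * (v ⬝ᵥ v) - (u ⬝ᵥ v) ^ 2) =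
      (w ⬝ᵥ u) * (v ⬝ᵥ v) - (w ⬝ᵥ v) * (u ⬝ᵥ v) := by
    rw [h]
    simp only [add_dotProduct, smul_dotProduct, smul_eq_mul, dotProduct_comm v u]
    ring
  have hv0 : 0 ≤ v ⬝ᵥ v := Finset.sum_nonneg fun i _ => mul_self_nonneg _
  calc |p| ≤ |p| * |(u ⬝ᵥ u) * (v ⬝ᵥ v) - (u ⬝ᵥ v) ^ 2| :=
        le_mul_of_one_le_right (abs_nonneg _) (hG.trans (le_abs_self _))
    _ = |(w ⬝ᵥ u) * (v ⬝ᵥ v) - (w ⬝ᵥ v) * (u ⬝ᵥ v)| := by rw [← abs_mul, h1]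
    _ ≤ _ := (abs_sub _ _).trans_eq (by rw [abs_mul, abs_mul, abs_of_nonneg hv0])

theorem abs_dotProduct_le {n : Type*} [Fintype n] (w u : n → ℤ) {B : ℤ} (hw : ∀ i, |w i| ≤ B) :
    |w ⬝ᵥ u| ≤ B * ∑ i, |u i| := by
  rw [dotProduct, Finset.mul_sum]
  refine (Finset.abs_sum_le_sum_abs _ _).trans (Finset.sum_le_sum fun i _ => ?_)
  rw [abs_mul]
  exact mul_le_mul_of_nonneg_right (hw i) (abs_nonneg _)

theorem abs_le_sum_abs {n : Type*} [Fintype n] (u : n → ℤ) (i : n) : |u i| ≤ ∑ i, |u i| :=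
  Finset.single_le_sum (f := fun i => |u i|) (fun _ _ => abs_nonneg _) (Finset.mem_univ i)

theorem exists_short_decomposition (a b : ℤ) {B : ℕ} (hB : 1 ≤ B) (ha : |a| ≤ B) (hb : |b| ≤ B) :
    ∃ (u v : Fin 3 → ℤ) (p q : ℤ) (m n : ℕ), ![1, a, b] = p • u + q • v ∧
      1 ≤ m ∧ 1 ≤ n ∧ ∑ i, |u i| = m ∧ ∑ i, |v i| = n ∧ (m * n) ^ 2 ≤ 108 * B ∧
      |p| ≤ 2 * B * (m * n) ^ 2 ∧ |q| ≤ 2 * B * (m * n) ^ 2 := by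
  obtain ⟨x, y, hxy, hxyB⟩ := exists_small_wedge a b hB ha hb
  have hG : ((![1, a, b] : Fin 3 → ℤ) ⬝ᵥ ![1, a, b]) * (![0, x, y] ⬝ᵥ ![0, x, y]) -
      (![1, a, b] ⬝ᵥ ![0, x, y]) ^ 2 = x ^ 2 + y ^ 2 + (a * y - b * x) ^ 2 := by
    simp [dotProduct, Fin.sum_univ_three]
    ring
  obtain ⟨u, v, p, q, hpq, hu, hv, h4, hGram⟩ := exists_reduced_pair ![1, a, b] ![0, x, y]
    (by rwa [hG])
  rw [hG] at hGram
  have hn0 : ∀ u : Fin 3 → ℤ, 0 ≤ ∑ i, |u i| := fun u => Finset.sum_nonneg fun _ _ => abs_nonneg _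
  have hn1 : ∀ u : Fin 3 → ℤ, u ⬝ᵥ u ≤ (∑ i, |u i|) ^ 2 := by
    intro u
    rw [sq]
    refine (le_abs_self _).trans (abs_dotProduct_le _ _ fun i => abs_le_sum_abs _ _)
  have hn3 : ∀ u : Fin 3 → ℤ, (∑ i, |u i|) ^ 2 ≤ 3 * (u ⬝ᵥ u) := by
    intro u
    have := sq_sum_le_card_mul_sum_sq (s := Finset.univ) (f := fun i => |u i|)
    simpa [dotProduct, sq] using this
  have hpos : ∀ u : Fin 3 → ℤ, 0 < u ⬝ᵥ u → 1 ≤ ∑ i, |u i| := by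
    intro u hu
    by_contra! hcon
    have h0 : ∑ i, |u i| = 0 := by
      have := hn0 u
      omega
    have := hn1 u
    rw [h0] at this
    linarith
  have hw : ∀ i, |(![1, a, b] : Fin 3 → ℤ) i| ≤ B := by
    have hB' : (1 : ℤ) ≤ B := by exact_mod_cast hB
    intro i
    fin_cases i
    · simpa using hB'
    · simpa using ha
    · simpa using hb
  obtain ⟨m, hm⟩ := Int.eq_ofNat_of_zero_le (hn0 u)
  obtain ⟨n, hn⟩ := Int.eq_ofNat_of_zero_le (hn0 v)
  have hm1 := hpos u hu
  have hn1' := hpos v hv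
  have hwu := abs_dotProduct_le _ u hw
  have hwv := abs_dotProduct_le _ v hw
  have huv := abs_dotProduct_le u v fun i => abs_le_sum_abs u i
  have hp := abs_coeff_mul_le hpq (by linarith)
  have hq := abs_coeff_mul_le (hpq.trans (add_comm _ _)) (by rw [dotProduct_comm v u]; linarith)
  rw [dotProduct_comm v u] at hq
  have hum := hn1 u
  have hvm := hn1 v
  have hu3 := hn3 u
  have hv3 := hn3 v
  rw [hm] at hum hu3 hm1 hwu huv
  rw [hn] at hvm hv3 hn1' hwv huv
  have hB0 : (0 : ℤ) ≤ B := by positivity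
  refine ⟨u, v, p, q, m, n, hpq, by exact_mod_cast hm1, by exact_mod_cast hn1', hm, hn, ?_, ?_, ?_⟩
  · have h5 : ((m : ℤ) * n) ^ 2 ≤ 108 * B := by
      have := mul_le_mul hu3 hv3 (by positivity) (by positivity)
      linarith
    exact_mod_cast h5
  · have h6 : |![1, a, b] ⬝ᵥ u| * (v ⬝ᵥ v) ≤ (B * m) * n ^ 2 := by gcongr
    have h7 : |![1, a, b] ⬝ᵥ v| * |u ⬝ᵥ v| ≤ (B * n) * (m * n) := by gcongr
    have h8 : (B * m * n ^ 2 : ℤ) ≤ B * (m * n) ^ 2 := by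
      have : (B * n ^ 2 : ℤ) * m ≤ (B * n ^ 2) * m ^ 2 := by
        gcongr
        nlinarith
      linarith
    linarith
  · have h6 : |![1, a, b] ⬝ᵥ v| * (u ⬝ᵥ u) ≤ (B * n) * m ^ 2 := by gcongr
    have h7 : |![1, a, b] ⬝ᵥ u| * |u ⬝ᵥ v| ≤ (B * m) * (m * n) := by gcongr
    have h8 : (B * n * m ^ 2 : ℤ) ≤ B * (m * n) ^ 2 := by
      have : (B * m ^ 2 : ℤ) * n ≤ (B * m ^ 2) * n ^ 2 := by
        gcongr
        nlinarith
      linarith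
    linarith

end Lattice

theorem exists_pow_unit {D : ℕ} {x y : ℤ} (h : |x ^ 2 - D * y ^ 2| = 1) (m : ℕ) :
    ∃ x' y' : ℤ, |x' ^ 2 - D * y' ^ 2| = 1 ∧ x' + y' * √(D : ℝ) = (x + y * √(D : ℝ)) ^ m := by
  have hs2 : √(D : ℝ) ^ 2 = D := sq_sqrt (Nat.cast_nonneg _)
  induction m with
  | zero => exact ⟨1, 0, by simp, by simp⟩
  | succ m ih =>
    obtain ⟨x', y', h1, h2⟩ := ih
    refine ⟨x' * x + D * y' * y, x' * y + y' * x, ?_, ?_⟩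
    · have e : (x' * x + D * y' * y) ^ 2 - D * (x' * y + y' * x) ^ 2 =
          (x' ^ 2 - D * y' ^ 2) * (x ^ 2 - D * y ^ 2) := by ring
      rw [e, abs_mul, h1, h, one_mul]
    · rw [pow_succ, ← h2]
      push_cast
      linear_combination (-(y' : ℝ) * y) * hs2

theorem exists_unit_log_mem_Icc {D : ℕ} {x y : ℤ} (h : |x ^ 2 - D * y ^ 2| = 1)
    (h1 : 1 < x + y * √(D : ℝ)) {H : ℝ} (hH : log (x + y * √(D : ℝ)) ≤ H) :
    ∃ x' y' : ℤ, |x' ^ 2 - D * y' ^ 2| = 1 ∧ 0 < x' + y' * √(D : ℝ) ∧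
      H ≤ log (x' + y' * √(D : ℝ)) ∧ log (x' + y' * √(D : ℝ)) ≤ 2 * H := by
  have hl := log_pos h1
  obtain ⟨x', y', h2, h3⟩ := exists_pow_unit h ⌈H / log (x + y * √(D : ℝ))⌉₊
  have h4 : H ≤ ⌈H / log (x + y * √(D : ℝ))⌉₊ * log (x + y * √(D : ℝ)) := by
    rw [← div_le_iff₀ hl]
    exact Nat.le_ceil _
  have h5 := Nat.ceil_lt_add_one (div_nonneg (hl.le.trans hH) hl.le)
  rw [← sub_lt_iff_lt_add, lt_div_iff₀ hl] at h5
  refine ⟨x', y', h2, ?_, ?_, ?_⟩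
  · rw [h3]
    positivity
  · rw [h3, log_pow]
    exact h4
  · rw [h3, log_pow]
    linarith

section Height

variable {ι : Type*} {S : Subring (ι → ℝ)}

theorem HeightLE.natCast {h : ℝ} {k : ℕ} (hk : k ≠ 0) (hkh : (k : ℝ) ≤ exp h) :
    HeightLE S h (k : ι → ℝ) := by
  have hk1 : (1 : ℝ) ≤ k := by exact_mod_cast Nat.one_le_iff_ne_zero.2 hk
  refine ⟨⟨k, Nat.pos_of_ne_zero hk, hkh, ?_, ?_⟩, fun i => ?_⟩
  · exact S.mul_mem (natCast_mem S k) (natCast_mem S k)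
  · have : (k : ι → ℝ) * (k : ι → ℝ)⁻¹ = 1 := by
      ext i
      simp [hk]
    rw [this]
    exact S.one_mem
  · simp only [Pi.natCast_apply, ne_eq, Nat.cast_eq_zero, hk, not_false_eq_true, Nat.abs_cast,
      true_and, abs_inv]
    exact ⟨hkh, (inv_le_one_of_one_le₀ hk1).trans (hk1.trans hkh)⟩

theorem HeightLE.of_mul_eq_intCast {h : ℝ} {x x' : ι → ℝ} (hx : x ∈ S) (hx' : x' ∈ S) {n : ℤ}
    (hn : n ≠ 0) (hxx : x * x' = n) (hnh : |(n : ℝ)| ≤ exp h) (hb : ∀ i, |x i| ≤ exp h)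
    (hb' : ∀ i, |x' i| ≤ exp h) : HeightLE S h x := by
  have hxi : ∀ i, x i * x' i = n := fun i => by simpa using congrFun hxx i
  have hn0 : (n : ℝ) ≠ 0 := by exact_mod_cast hn
  have hx0 : ∀ i, x i ≠ 0 := fun i h0 => hn0 (by rw [← hxi i, h0, zero_mul])
  have hinv : ∀ i, (x i)⁻¹ = x' i / n := fun i => by
    rw [eq_div_iff hn0, ← hxi i, ← mul_assoc, inv_mul_cancel₀ (hx0 i), one_mul]
  have hn1 : (1 : ℝ) ≤ |(n : ℝ)| := by exact_mod_cast Int.one_le_abs hn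
  refine ⟨⟨n.natAbs, Int.natAbs_pos.2 hn, ?_, ?_, ?_⟩, fun i => ⟨hx0 i, hb i, ?_⟩⟩
  · rwa [Nat.cast_natAbs, Int.cast_abs]
  · exact S.mul_mem (natCast_mem S _) hx
  · rcases Int.natAbs_eq n with h1 | h1
    · have : ((n.natAbs : ℕ) : ι → ℝ) * x⁻¹ = x' := by
        ext i
        have h2 : ((n.natAbs : ℕ) : ℝ) = n := by
          have := congrArg (Int.cast : ℤ → ℝ) h1.symm
          rwa [Int.cast_natCast] at this
        simp only [Pi.mul_apply, Pi.inv_apply, Pi.natCast_apply, hinv, h2]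
        field_simp
      rwa [this]
    · have : ((n.natAbs : ℕ) : ι → ℝ) * x⁻¹ = -x' := by
        ext i
        have h2 : ((n.natAbs : ℕ) : ℝ) = -n := by
          have := congrArg (Int.cast : ℤ → ℝ) (show ((n.natAbs : ℕ) : ℤ) = -n by omega)
          rwa [Int.cast_natCast, Int.cast_neg] at this
        simp only [Pi.mul_apply, Pi.inv_apply, Pi.natCast_apply, Pi.neg_apply, hinv, h2]
        field_simp
      rw [this]
      exact S.neg_mem hx'
  · rw [hinv, abs_div]
    exact (div_le_self (abs_nonneg _) hn1).trans (hb' i)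

theorem zpow_mem_of_mul_eq {x x' : ι → ℝ} (hx : x ∈ S) (hx' : x' ∈ S) {n : ℤ} (hn : |n| = 1)
    (hxx : x * x' = n) (k : ℤ) : x ^ k ∈ S := by
  have hinv : x⁻¹ ∈ S := by
    have : x⁻¹ = n * x' := by
      ext i
      have hxi : x i * x' i = n := by simpa using congrFun hxx i
      have hn2 : (n : ℝ) * n = 1 := by
        have : n * n = 1 := by rw [← abs_mul_abs_self, hn, one_mul]
        exact_mod_cast this
      have h0 : x i ≠ 0 := by
        intro h0
        rw [h0, zero_mul] at hxi
        rw [← hxi] at hn2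
        simp at hn2
      simp only [Pi.inv_apply, Pi.mul_apply, Pi.intCast_apply]
      field_simp
      linear_combination -n * hxi - hn2
    rw [this]
    exact S.mul_mem (intCast_mem S n) hx'
  rcases Int.eq_nat_or_neg k with ⟨m, rfl | rfl⟩
  · rw [zpow_natCast]
    exact S.pow_mem hx m
  · rw [zpow_neg, zpow_natCast, ← inv_pow]
    exact S.pow_mem hinv m

theorem exists_reduced_multiple {o : ι} {D : ℕ} {v : ι → ℝ} (hvS : v ∈ S)
    (hv : ∀ i, v i = √D ∨ v i = -√D) (hvo : v o = √D) {H : ℝ} (hH : 1 ≤ H) {x y : ℤ}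
    (hxy : |x ^ 2 - D * y ^ 2| = 1) (hpos : 0 < x + y * √(D : ℝ))
    (hl1 : H ≤ log (x + y * √(D : ℝ))) (hl2 : log (x + y * √(D : ℝ)) ≤ 2 * H) {A B : ℤ}
    (hn : A ^ 2 - D * B ^ 2 ≠ 0) (hnH : |((A ^ 2 - D * B ^ 2 : ℤ) : ℝ)| ≤ exp H)
    (hAB : 0 < A + B * √(D : ℝ)) :
    ∃ (γ e : ι → ℝ) (a : ℤ), HeightLE S (2 * H) γ ∧ HeightLE S (2 * H) e ∧ 0 < γ o ∧ 0 < e o ∧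
      log (A + B * √(D : ℝ)) = log (γ o) + a * log (e o) ∧
      |(a : ℝ)| ≤ |log (A + B * √(D : ℝ))| / H + 1 := by
  have hs2 : √(D : ℝ) ^ 2 = D := sq_sqrt (Nat.cast_nonneg _)
  have hv2 : ∀ i, v i ^ 2 = D := by
    intro i
    rcases hv i with h | h <;> rw [h]
    · exact hs2
    · rw [neg_sq, hs2]
  set s := √(D : ℝ) with hs
  set η : ℝ := x + y * s with hη
  set β₀ : ℝ := A + B * s with hβ₀
  have hH0 : 0 < H := by linarith
  have hlη : 0 < log η := by linarith
  set a : ℤ := ⌊log β₀ / log η⌋ with ha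
  have ha1 : a * log η ≤ log β₀ := by
    rw [← le_div_iff₀ hlη]
    exact Int.floor_le _
  have ha2 : log β₀ < (a + 1) * log η := by
    rw [← div_lt_iff₀ hlη]
    exact Int.lt_floor_add_one _
  let e : ι → ℝ := x + y * v
  let e' : ι → ℝ := x - y * v
  let β : ι → ℝ := A + B * v
  let β' : ι → ℝ := A - B * v
  have hei : ∀ i, e i = x + y * v i := fun i => by simp [e]
  have hei' : ∀ i, e' i = x - y * v i := fun i => by simp [e']
  have hβi : ∀ i, β i = A + B * v i := fun i => by simp [β]
  have hβi' : ∀ i, β' i = A - B * v i := fun i => by simp [β']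
  have heS : e ∈ S := S.add_mem (intCast_mem S x) (S.mul_mem (intCast_mem S y) hvS)
  have heS' : e' ∈ S := S.sub_mem (intCast_mem S x) (S.mul_mem (intCast_mem S y) hvS)
  have hβS : β ∈ S := S.add_mem (intCast_mem S A) (S.mul_mem (intCast_mem S B) hvS)
  have hβS' : β' ∈ S := S.sub_mem (intCast_mem S A) (S.mul_mem (intCast_mem S B) hvS)
  have hee : e * e' = ((x ^ 2 - D * y ^ 2 : ℤ) : ι → ℝ) := by
    ext i
    simp only [Pi.mul_apply, Pi.intCast_apply, hei, hei']
    push_cast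
    rw [← hv2 i]
    ring
  have hββ : β * β' = ((A ^ 2 - D * B ^ 2 : ℤ) : ι → ℝ) := by
    ext i
    simp only [Pi.mul_apply, Pi.intCast_apply, hβi, hβi']
    push_cast
    rw [← hv2 i]
    ring
  have heo : e o = η := by rw [hei, hvo]
  have hβo : β o = β₀ := by rw [hβi, hvo]
  have hnorm : |η| * |x - y * s| = 1 := by
    rw [← abs_mul]
    have h1 : η * (x - y * s) = ((x ^ 2 - D * y ^ 2 : ℤ) : ℝ) := by
      push_cast
      rw [← hs2]
      ring
    rw [h1]
    exact_mod_cast hxy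
  rw [abs_of_pos hpos] at hnorm
  have hconj : |x - y * s| = η⁻¹ := eq_inv_of_mul_eq_one_right hnorm
  have he : ∀ i, |e i| = η ∨ |e i| = η⁻¹ := by
    intro i
    rcases hv i with h | h
    · left
      rw [hei, h, abs_of_pos hpos]
    · right
      rw [hei, h, ← hconj, mul_neg, sub_eq_add_neg]
  have hηle : η ≤ exp (2 * H) := (log_le_iff_le_exp hpos).1 hl2
  have hη1 : 1 < η := (log_pos_iff hpos.le).1 hlη
  have hηinv : η⁻¹ ≤ exp (2 * H) := (inv_le_one_of_one_le₀ hη1.le).trans (by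
    rw [one_le_exp_iff]; linarith)
  have heb : ∀ i, |e i| ≤ exp (2 * H) := by
    intro i
    rcases he i with h | h <;> rw [h] <;> assumption
  have he0 : ∀ i, e i ≠ 0 := by
    intro i h0
    rcases he i with h | h <;> rw [h0, abs_zero] at h
    · exact hpos.ne h
    · exact (inv_pos.2 hpos).ne h
  have heb' : ∀ i, |e' i| ≤ exp (2 * H) := by
    intro i
    rcases hv i with h | h
    · rw [hei', h, hconj]
      exact hηinv
    · rw [hei', h, mul_neg, sub_neg_eq_add, abs_of_pos hpos]
      exact hηle
  have hxy0 : x ^ 2 - (D : ℤ) * y ^ 2 ≠ 0 := by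
    intro h
    rw [h] at hxy
    simp at hxy
  have hγo : 1 ≤ β₀ * η ^ (-a) ∧ β₀ * η ^ (-a) ≤ exp (2 * H) := by
    have h1 : log (β₀ * η ^ (-a)) = log β₀ - a * log η := by
      rw [log_mul hAB.ne' (zpow_pos hpos _).ne', log_zpow]
      push_cast
      ring
    have h2 : 0 < β₀ * η ^ (-a) := mul_pos hAB (zpow_pos hpos _)
    constructor
    · rw [← log_nonneg_iff h2, h1]
      linarith
    · rw [← log_le_iff_le_exp h2, h1]
      linarith
  have hγo' : |A - B * s| * η ^ a ≤ exp (2 * H) := by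
    have h1 : (β₀ * η ^ (-a)) * (|A - B * s| * η ^ a) = |((A ^ 2 - D * B ^ 2 : ℤ) : ℝ)| := by
      have h2 : ((A ^ 2 - D * B ^ 2 : ℤ) : ℝ) = β₀ * (A - B * s) := by
        push_cast
        rw [← hs2]
        ring
      rw [h2, abs_mul, abs_of_pos hAB, zpow_neg]
      have := (zpow_pos hpos a).ne'
      field_simp
    have h3 : 0 ≤ |A - B * s| * η ^ a := mul_nonneg (abs_nonneg _) (zpow_pos hpos _).le
    calc _ ≤ (β₀ * η ^ (-a)) * (|A - B * s| * η ^ a) := le_mul_of_one_le_left h3 hγo.1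
      _ ≤ exp H := by rw [h1]; exact hnH
      _ ≤ _ := exp_le_exp.2 (by linarith)
  refine ⟨β * e ^ (-a), e, a, ?_, ?_, ?_, ?_, ?_, ?_⟩
  · refine HeightLE.of_mul_eq_intCast (x' := β' * e ^ a)
      (S.mul_mem hβS (zpow_mem_of_mul_eq heS heS' hxy hee _))
      (S.mul_mem hβS' (zpow_mem_of_mul_eq heS heS' hxy hee _)) hn ?_
      (hnH.trans (exp_le_exp.2 (by linarith))) ?_ ?_
    · rw [← hββ]
      ext i
      simp only [Pi.mul_apply, zpow_neg, Pi.inv_apply, Pi.pow_apply]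
      have := zpow_ne_zero a (he0 i)
      field_simp
    · intro i
      rw [Pi.mul_apply, Pi.pow_apply, abs_mul, abs_zpow, hβi]
      rcases hv i with h | h
      · rw [hei, h, abs_of_pos hpos, abs_of_pos hAB]
        exact hγo.2
      · rw [hei, h, mul_neg, mul_neg, ← sub_eq_add_neg, ← sub_eq_add_neg, hconj, inv_zpow', neg_neg]
        exact hγo'
    · intro i
      rw [Pi.mul_apply, Pi.pow_apply, abs_mul, abs_zpow, hβi']
      rcases hv i with h | h
      · rw [hei, h, abs_of_pos hpos]
        exact hγo'
      · rw [hei, h, mul_neg, mul_neg, sub_neg_eq_add, ← sub_eq_add_neg, hconj, inv_zpow',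
          abs_of_pos hAB]
        exact hγo.2
  · exact HeightLE.of_mul_eq_intCast heS heS' hxy0 hee (by
      rw [← Int.cast_abs, hxy]
      simpa using by linarith) heb heb'
  · rw [Pi.mul_apply, Pi.pow_apply, heo, hβo]
    exact mul_pos hAB (zpow_pos hpos _)
  · rw [heo]
    exact hpos
  · rw [Pi.mul_apply, Pi.pow_apply, heo, hβo, log_mul hAB.ne' (zpow_pos hpos _).ne', log_zpow]
    push_cast
    ring
  · have h1 : |log β₀ / log η| ≤ |log β₀| / H := by
      rw [abs_div, abs_of_pos hlη]
      gcongr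
    have h2 := Int.floor_le (log β₀ / log η)
    have h3 := Int.lt_floor_add_one (log β₀ / log η)
    rw [← ha] at h2 h3
    rw [abs_le] at h1 ⊢
    constructor <;> linarith [h1.1, h1.2]

end Height

set_option maxHeartbeats 1000000 in
theorem false_of_small_two_term_form {ι : Type*} [Fintype ι] (hι : Fintype.card ι = 4)
    {S : Subring (ι → ℝ)} {o : ι} (hS : HasNormGeOne S o) {s : ℝ} (hs : 10 ^ 9 ≤ s)
    (hls : log s ≤ s / 10 ^ 6) {m n B : ℕ} (hm : 1 ≤ m) (hn : 1 ≤ n) (hmn : (m * n) ^ 2 ≤ 108 * B)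
    (hB : (B : ℝ) ≤ s ^ 245) {x y : ι → ℝ} (hx : HeightLE S (7 * s ^ 105 * m) x)
    (hy : HeightLE S (7 * s ^ 105 * n) y) (hxo : 0 < x o) (hyo : 0 < y o) {p q : ℤ}
    (hp : |(p : ℝ)| ≤ 2 * B * (m * n) ^ 2) (hq : |(q : ℝ)| ≤ 2 * B * (m * n) ^ 2) (hq0 : q ≠ 0)
    (hΛ0 : p * log (x o) + q * log (y o) ≠ 0)
    (hΛ : |p * log (x o) + q * log (y o)| ≤ exp (-s ^ 345)) : False := by
  set Λ := p * log (x o) + q * log (y o) with hΛdef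
  have hs1 : 1 ≤ s := le_trans (by norm_num) hs
  have hs0 : 0 < s := by linarith
  set H := s ^ 105 with hH
  have hH1 : 1 ≤ H := one_le_pow₀ hs1
  obtain ⟨L, hL1, hL2⟩ : ∃ L : ℕ, s ≤ L ∧ (L : ℝ) ≤ s ^ 2 :=
    ⟨⌈s⌉₊, Nat.le_ceil s, (Nat.ceil_lt_add_one hs0.le).le.trans (by nlinarith)⟩
  obtain ⟨k, hk1, hk2⟩ : ∃ k : ℕ, 3000 * H ≤ k ∧ (k : ℝ) ≤ s ^ 106 := by
    refine ⟨⌈3000 * H⌉₊, Nat.le_ceil _, (Nat.ceil_lt_add_one (by positivity)).le.trans ?_⟩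
    rw [pow_succ, ← hH]
    nlinarith
  have hP2 : ((m : ℝ) * n) ≤ s ^ 124 := by
    have h1 : ((m : ℝ) * n) ^ 2 ≤ 108 * B := by exact_mod_cast hmn
    refine (sq_le_sq₀ (by positivity) (by positivity)).1 (h1.trans ?_)
    calc 108 * (B : ℝ) ≤ s * s ^ 245 := by gcongr; linarith
      _ = s ^ 246 := by ring
      _ ≤ s ^ 248 := pow_le_pow_right₀ hs1 (by norm_num)
      _ = _ := by ring
  have hm' : (1 : ℝ) ≤ m := by exact_mod_cast hm
  have hn' : (1 : ℝ) ≤ n := by exact_mod_cast hn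
  have hP1 : 1 ≤ (m : ℝ) * n := one_le_mul_of_one_le_of_one_le hm' hn'
  have hmP : (m : ℝ) ≤ m * n := le_mul_of_one_le_right (by linarith) hn'
  have hnP : (n : ℝ) ≤ m * n := le_mul_of_one_le_left (by linarith) hm'
  set P := (m : ℝ) * n with hP
  have hL0 : (0 : ℝ) < L := by linarith
  have hk0 : (0 : ℝ) < k := by linarith
  have hLk : (L : ℝ) * k ≤ s ^ 108 := by
    calc (L : ℝ) * k ≤ s ^ 2 * s ^ 106 := by gcongr
      _ = _ := by ring
  have hR2 : (L : ℝ) * k * n ≤ s ^ 232 := by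
    calc (L : ℝ) * k * n ≤ s ^ 108 * s ^ 124 := by gcongr; exact hnP.trans hP2
      _ = _ := by ring
  have hT2 : (L : ℝ) * k * m ≤ s ^ 232 := by
    calc (L : ℝ) * k * m ≤ s ^ 108 * s ^ 124 := by gcongr; exact hmP.trans hP2
      _ = _ := by ring
  have hpq : ∀ r : ℤ, |(r : ℝ)| ≤ 2 * B * P ^ 2 → |(r : ℝ)| ≤ s ^ 494 := by
    intro r hr
    calc _ ≤ _ := hr
      _ ≤ s * s ^ 245 * (s ^ 124) ^ 2 := by gcongr; linarith
      _ = _ := by ring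
  have hp' := hpq p hp
  have hq' := hpq q hq
  set Z : ℝ := (2 * (L * k * n) : ℕ) * |(q : ℝ)| + (2 * (L * k * m) : ℕ) * |(p : ℝ)| with hZ
  set W : ℝ := (2 * (L * k * n) : ℕ) * (7 * H * m) + (2 * (L * k * m) : ℕ) * (7 * H * n) with hW
  have hWeq : W = 28 * L * k * H * P := by
    rw [hW, hP]
    push_cast
    ring
  have hq1 : (1 : ℝ) ≤ |(q : ℝ)| := by exact_mod_cast Int.one_le_abs hq0
  have hZ0 : 0 < Z := by
    rw [hZ]
    push_cast
    positivity
  have hZ2 : Z ≤ s ^ 727 := by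
    rw [hZ]
    push_cast
    calc _ ≤ 2 * s ^ 232 * s ^ 494 + 2 * s ^ 232 * s ^ 494 := by gcongr
      _ = 4 * s ^ 726 := by ring
      _ ≤ s * s ^ 726 := by gcongr; linarith
      _ = _ := by ring
  have hlZ : log Z ≤ 727 * log s := by
    refine (log_le_log hZ0 hZ2).trans_eq ?_
    rw [log_pow]
    norm_num
  set N' : ℝ := (L : ℝ) ^ 2 * k ^ 2 * P with hN'
  have hNK : N' = (L * k ^ 2 * P) * L := by rw [hN']; ring
  have hN1 : s ^ 2 ≤ N' := by
    calc s ^ 2 = s ^ 2 * 1 ^ 2 * 1 := by ring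
      _ ≤ (L : ℝ) ^ 2 * k ^ 2 * P := by gcongr; linarith
  have hN2 : N' ≤ s ^ 340 := by
    calc N' = (L * k) ^ 2 * P := by rw [hN']; ring
      _ ≤ (s ^ 108) ^ 2 * s ^ 124 := by gcongr
      _ = _ := by ring
  have hLW : L * W * 100 ≤ N' := by
    calc L * W * 100 = (L ^ 2 * k * P) * (2800 * H) := by rw [hWeq]; ring
      _ ≤ (L ^ 2 * k * P) * k := by gcongr; linarith
      _ = N' := by rw [hN']; ring
  have hW0 : 1 ≤ W := by
    rw [hWeq]
    calc (1 : ℝ) = 1 * 1 * 1 * 1 * 1 := by ring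
      _ ≤ _ := by gcongr <;> linarith
  have hLW1 : W ≤ L * W := le_mul_of_one_le_left (by linarith) (by linarith)
  have hWN : W ≤ N' := by linarith
  have hs340 : s ≤ s ^ 340 := le_self_pow₀ hs1 (by norm_num)
  have hs345 : 10 ^ 9 * s ^ 340 ≤ s ^ 345 := by
    calc 10 ^ 9 * s ^ 340 ≤ s * s ^ 340 := by gcongr
      _ = s ^ 341 := by ring
      _ ≤ s ^ 345 := pow_le_pow_right₀ hs1 (by norm_num)
  have hN7 : s * 10 ^ 9 ≤ N' := by
    refine le_trans ?_ hN1
    rw [sq]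
    gcongr
  have hcast : ((L * k ^ 2 * (m * n) * L : ℕ) : ℝ) = N' := by
    rw [hNK, hP]
    push_cast
    ring
  have hlogN : log (N' + 1) ≤ 341 * log s := by
    have : N' + 1 ≤ s ^ 341 := by
      calc N' + 1 ≤ s ^ 340 + s ^ 340 := by linarith
        _ = 2 * s ^ 340 := by ring
        _ ≤ s * s ^ 340 := by gcongr; linarith
        _ = _ := by ring
    refine (log_le_log (by linarith) this).trans_eq ?_
    rw [log_pow]
    norm_num
  have hexp : ∀ j : ℕ, s ^ j = exp (j * log s) := fun j => by
    rw [← log_pow, exp_log (by positivity)]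
  refine false_of_small_linear_form hS hx hy hxo hyo p q hq0 (K := L * k ^ 2 * (m * n)) (L := L)
    (R := L * k * n) (T := L * k * m) ?_ ?_ ?_ ?_ ?_ Z W Λ hZ hW rfl hΛ0 ?_ ?_ ?_
  · have h1 : 0 < L := by exact_mod_cast hL0
    have h2 : 0 < k := by exact_mod_cast hk0
    exact Nat.succ_le_of_lt (by positivity)
  · exact_mod_cast hL0
  · have h1 : 0 < L := by exact_mod_cast hL0
    have h2 : 0 < k := by exact_mod_cast hk0
    exact Nat.succ_le_of_lt (by positivity)
  · have h1 : 0 < L := by exact_mod_cast hL0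
    have h2 : 0 < k := by exact_mod_cast hk0
    exact Nat.succ_le_of_lt (by positivity)
  · apply le_of_eq
    ring
  · rw [hcast]
    push_cast
    calc 2 * (L : ℝ) * (2 * (L * k * m)) * |Λ| * exp N'
        ≤ 2 * s ^ 2 * (2 * s ^ 232) * exp (-s ^ 345) * exp (s ^ 340) := by gcongr
      _ = 4 * s ^ 234 * (exp (-s ^ 345) * exp (s ^ 340)) := by ring
      _ ≤ s * s ^ 234 * (exp (-s ^ 345) * exp (s ^ 340)) := by gcongr; linarith
      _ = exp ((235 : ℕ) * log s + (-s ^ 345 + s ^ 340)) := by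
        rw [exp_add, ← hexp, exp_add]
        ring
      _ ≤ 1 := by
        rw [exp_le_one_iff]
        push_cast
        linarith
  · rw [hι]
    push_cast
    calc 2 * ((L : ℝ) * k * n + L * k * m) * |Λ|
        ≤ 2 * (s ^ 232 + s ^ 232) * exp (-s ^ 345) := by gcongr
      _ = 4 * s ^ 232 * exp (-s ^ 345) := by ring
      _ ≤ s * s ^ 232 * exp (-s ^ 345) := by gcongr; linarith
      _ = exp ((233 : ℕ) * log s + -s ^ 345) := by
        rw [exp_add, ← hexp]
        ring
      _ < _ := by
        rw [exp_lt_exp]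
        push_cast
        linarith
  · rw [hι, hcast]
    push_cast
    have hK0 : 0 ≤ (L : ℝ) * k ^ 2 * P := by positivity
    have h1 : (L * k ^ 2 * P) * (1 + 4 * log Z) ≤ N' / 8 := by
      rw [hNK, mul_div_assoc]
      gcongr
      linarith
    have h2 : exp 1 * (L * (W + 1)) ≤ 6 * (L * W) := by
      have h3 : L * (W + 1) ≤ 2 * (L * W) := by
        have := mul_le_mul_of_nonneg_left hW0 hL0.le
        linarith
      have h4 := exp_one_lt_d9
      have h5 : 0 ≤ (L : ℝ) * (W + 1) := by positivity
      calc exp 1 * (L * (W + 1)) ≤ 3 * (2 * (L * W)) := by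
            gcongr
            linarith
        _ = _ := by ring
    have h6 := log_two_lt_d9
    rw [← hP]
    linarith

theorem HeightLE.prod_zpow {ι : Type*} {S : Subring (ι → ℝ)} {h : ℝ} {x y z : ι → ℝ}
    (hx : HeightLE S h x) (hy : HeightLE S h y) (hz : HeightLE S h z) (u : Fin 3 → ℤ) {m : ℕ}
    (hu : ∑ i, |u i| = m) : HeightLE S (h * m) (x ^ u 0 * y ^ u 1 * z ^ u 2) := by
  refine (((hx.zpow (u 0)).mul (hy.zpow (u 1))).mul (hz.zpow (u 2))).mono (le_of_eq ?_)
  have h1 : (m : ℝ) = |(u 0 : ℝ)| + |(u 1 : ℝ)| + |(u 2 : ℝ)| := by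
    rw [Fin.sum_univ_three] at hu
    exact_mod_cast hu.symm
  rw [h1]
  ring

theorem log_prod_zpow {ι : Type*} {o : ι} {x y z : ι → ℝ} (hx : 0 < x o) (hy : 0 < y o)
    (hz : 0 < z o) (u : Fin 3 → ℤ) : log ((x ^ u 0 * y ^ u 1 * z ^ u 2) o) =
      u 0 * log (x o) + u 1 * log (y o) + u 2 * log (z o) := by
  have h0 := zpow_pos hx (u 0)
  have h1 := zpow_pos hy (u 1)
  have h2 := zpow_pos hz (u 2)
  simp only [Pi.mul_apply, Pi.pow_apply]
  rw [log_mul (by positivity) h2.ne', log_mul h0.ne' h1.ne', log_zpow, log_zpow, log_zpow]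

theorem false_of_small_three_term_form {ι : Type*} [Fintype ι] (hι : Fintype.card ι = 4)
    {S : Subring (ι → ℝ)} {o : ι} (hS : HasNormGeOne S o) {s : ℝ} (hs : 10 ^ 9 ≤ s)
    (hls : log s ≤ s / 10 ^ 6) {x y z : ι → ℝ} (hx : HeightLE S (7 * s ^ 105) x)
    (hy : HeightLE S (7 * s ^ 105) y) (hz : HeightLE S (7 * s ^ 105) z) (hxo : 0 < x o)
    (hyo : 0 < y o) (hzo : 0 < z o) {a b : ℤ} (ha : |(a : ℝ)| ≤ s ^ 245)
    (hb : |(b : ℝ)| ≤ s ^ 245) (hΛ0 : log (x o) + a * log (y o) + b * log (z o) ≠ 0)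
    (hΛ : |log (x o) + a * log (y o) + b * log (z o)| ≤ exp (-s ^ 345)) : False := by
  have hs1 : 1 ≤ s := le_trans (by norm_num) hs
  have hs245 : 1 ≤ s ^ 245 := one_le_pow₀ hs1
  have hB : ((⌊s ^ 245⌋₊ : ℕ) : ℝ) ≤ s ^ 245 := Nat.floor_le (by positivity)
  have key : ∀ r : ℤ, |(r : ℝ)| ≤ s ^ 245 → |r| ≤ (⌊s ^ 245⌋₊ : ℕ) := by
    intro r hr
    rw [Int.abs_eq_natAbs]
    norm_cast
    apply Nat.le_floor
    rwa [Nat.cast_natAbs, Int.cast_abs]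
  obtain ⟨u, v, p, q, m, n, huv, hm, hn, hu, hv, hmn, hp, hq⟩ :=
    exists_short_decomposition a b (Nat.le_floor (by exact_mod_cast hs245)) (key a ha) (key b hb)
  have h0 := congrFun huv 0
  have h1 := congrFun huv 1
  have h2 := congrFun huv 2
  simp at h0 h1 h2
  have h0' : (1 : ℝ) = p * u 0 + q * v 0 := by exact_mod_cast h0
  have h1' : (a : ℝ) = p * u 1 + q * v 1 := by exact_mod_cast h1
  have h2' : (b : ℝ) = p * u 2 + q * v 2 := by exact_mod_cast h2
  have hpos : ∀ w : Fin 3 → ℤ, 0 < (x ^ w 0 * y ^ w 1 * z ^ w 2) o := by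
    intro w
    simp only [Pi.mul_apply, Pi.pow_apply]
    exact mul_pos (mul_pos (zpow_pos hxo _) (zpow_pos hyo _)) (zpow_pos hzo _)
  have hΛeq : log (x o) + a * log (y o) + b * log (z o) =
      p * log ((x ^ u 0 * y ^ u 1 * z ^ u 2) o) + q * log ((x ^ v 0 * y ^ v 1 * z ^ v 2) o) := by
    rw [log_prod_zpow hxo hyo hzo, log_prod_zpow hxo hyo hzo, h1', h2']
    linear_combination log (x o) * h0'
  have hp' : |(p : ℝ)| ≤ 2 * (⌊s ^ 245⌋₊ : ℕ) * (m * n) ^ 2 := by exact_mod_cast hp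
  have hq' : |(q : ℝ)| ≤ 2 * (⌊s ^ 245⌋₊ : ℕ) * (m * n) ^ 2 := by exact_mod_cast hq
  rw [hΛeq] at hΛ0 hΛ
  rcases eq_or_ne q 0 with hq0 | hq0
  · have hp0 : p ≠ 0 := by
      rintro rfl
      rw [hq0] at hΛ0
      simp at hΛ0
    rw [add_comm] at hΛ0 hΛ
    rw [mul_comm (m : ℝ)] at hp' hq'
    exact false_of_small_two_term_form hι hS hs hls hn hm (by rwa [mul_comm n]) hB
      (hx.prod_zpow hy hz v hv) (hx.prod_zpow hy hz u hu) (hpos v) (hpos u) hq' hp' hp0 hΛ0 hΛ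
  · exact false_of_small_two_term_form hι hS hs hls hm hn hmn hB (hx.prod_zpow hy hz u hu)
      (hx.prod_zpow hy hz v hv) (hpos u) (hpos v) hp' hq' hq0 hΛ0 hΛ

theorem not_isSquare_mul_of_sq_eq {X k₁ k₂ b₁ b₂ : ℤ} (h₁ : b₁ ^ 2 = k₁ * (X - k₁))
    (h₂ : b₂ ^ 2 = k₂ * (X - k₂)) (hk₁ : 0 < k₁) (hk₂ : 0 < k₂) (hne : k₁ ≠ k₂)
    (hX : (k₁ - k₂) ^ 2 < 2 * (2 * X - k₁ - k₂) - 1) : ¬IsSquare (k₁ * k₂) := by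
  rintro ⟨m, hm⟩
  have hm0 : m ≠ 0 := by
    rintro rfl
    simp [hk₁.ne', hk₂.ne'] at hm
  have hdvd : m ^ 2 ∣ (b₁ * b₂) ^ 2 := ⟨(X - k₁) * (X - k₂), by
    rw [mul_pow, h₁, h₂, sq, ← hm]
    ring⟩
  obtain ⟨t, ht⟩ := (Int.pow_dvd_pow_iff two_ne_zero).1 hdvd
  have ht2 : |t| ^ 2 = (X - k₁) * (X - k₂) := by
    rw [sq_abs]
    apply mul_left_cancel₀ (pow_ne_zero 2 hm0)
    rw [← mul_pow, ← ht, mul_pow, h₁, h₂, sq, ← hm]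
    ring
  have h3 : (2 * X - k₁ - k₂) ^ 2 - (2 * |t|) ^ 2 = (k₁ - k₂) ^ 2 := by
    linear_combination -4 * ht2
  have h4 : 0 < (k₁ - k₂) ^ 2 := by
    have := sub_ne_zero.2 hne
    positivity
  have h5 := abs_nonneg t
  have h6 : 2 * |t| < 2 * X - k₁ - k₂ := by nlinarith
  nlinarith

theorem not_isSquare_sq_mul {k m : ℤ} (hk : k ≠ 0) (hm : ¬IsSquare m) :
    ¬IsSquare (k ^ 2 * m) := by
  rintro ⟨t, ht⟩
  obtain ⟨u, rfl⟩ := (Int.pow_dvd_pow_iff two_ne_zero).1 (⟨m, by rw [sq t, ht]⟩ : k ^ 2 ∣ t ^ 2)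
  refine hm ⟨u, mul_left_cancel₀ (pow_ne_zero 2 hk) ?_⟩
  rw [ht]
  ring

theorem abs_log_sub_log_le {u v : ℝ} (hu : 1 ≤ u) (hv : 1 ≤ v) : |log u - log v| ≤ |u - v| := by
  wlog h : v ≤ u generalizing u v
  · rw [abs_sub_comm, abs_sub_comm u]
    exact this hv hu (le_of_not_ge h)
  have h0 : 0 < v := by linarith
  rw [abs_of_nonneg (sub_nonneg.2 (log_le_log h0 h)), abs_of_nonneg (sub_nonneg.2 h),
    ← log_div (by linarith) h0.ne']
  refine (log_le_sub_one_of_pos (by positivity)).trans ?_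
  rw [div_sub_one h0.ne']
  exact div_le_self (sub_nonneg.2 h) hv

theorem abs_sqrt_sub_sqrt_le {u v : ℝ} (hu : 0 < u) (hv : 0 < v) :
    |√u - √v| ≤ |u - v| / √u := by
  have h1 := sqrt_pos.2 hu
  have h2 := sqrt_pos.2 hv
  rw [le_div_iff₀ h1]
  have h3 : u - v = (√u - √v) * (√u + √v) := by
    rw [mul_comm, ← sq_sub_sq, sq_sqrt hu.le, sq_sqrt hv.le]
  rw [h3, abs_mul, abs_of_pos (by positivity : 0 < √u + √v)]
  gcongr
  linarith

theorem exists_reduced_sqrt_add_sqrt {C : ℝ}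
    (hC : ∀ D : ℕ, ¬IsSquare (D : ℤ) → ∃ x y : ℤ, |x ^ 2 - D * y ^ 2| = 1 ∧
      1 < x + y * √(D : ℝ) ∧ log (x + y * √(D : ℝ)) ≤ C * (D : ℝ) ^ ((51 : ℝ) / 100))
    {s : ℝ} (hs : 10 ^ 9 ≤ s) (hls : log s ≤ s / 10 ^ 6) (hCs : C ≤ s) {ι : Type*}
    {S : Subring (ι → ℝ)} {o : ι} {X k₁ k₂ : ℕ} {b₁ b₂ : ℤ}
    (h₁ : b₁ ^ 2 = k₁ * (X - k₁)) (h₂ : b₂ ^ 2 = k₂ * (X - k₂)) (hb₁ : 0 < b₁) (hb₂ : 0 < b₂)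
    (hk₁ : 0 < k₁) (hk₂ : 0 < k₂) (hne : k₁ ≠ k₂) (hk₁s : (k₁ : ℝ) ≤ s ^ 100)
    (hk₂s : (k₂ : ℝ) ≤ s ^ 100) (hkX₁ : k₁ < X) (hkX₂ : k₂ < X) (hX : (X : ℝ) ≤ exp (s ^ 350))
    (hsq : ¬IsSquare ((k₁ * k₂ : ℕ) : ℤ)) {v : ι → ℝ} (hvS : v ∈ S)
    (hv : ∀ i, v i = √(k₁ * k₂ : ℕ) ∨ v i = -√(k₁ * k₂ : ℕ)) (hvo : v o = √(k₁ * k₂ : ℕ)) :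
    ∃ (γ e : ι → ℝ) (a : ℤ), HeightLE S (2 * s ^ 105) γ ∧ HeightLE S (2 * s ^ 105) e ∧ 0 < γ o ∧
      0 < e o ∧ log (γ o) + a * log (e o) =
        log √k₁ + log k₂ + log (√(X - k₁) + √(X - k₂)) ∧ |(a : ℝ)| ≤ s ^ 245 := by
  have hs1 : 1 ≤ s := le_trans (by norm_num) hs
  have hs0 : 0 < s := by linarith
  have hH1 : 1 ≤ s ^ 105 := one_le_pow₀ hs1
  have hexp : ∀ j : ℕ, s ^ j = exp (j * log s) := fun j => by
    rw [← log_pow, exp_log (by positivity)]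
  have hk₁1 : (1 : ℝ) ≤ k₁ := by exact_mod_cast hk₁
  have hk₂1 : (1 : ℝ) ≤ k₂ := by exact_mod_cast hk₂
  have hX₁ : (0 : ℝ) < X - k₁ := sub_pos.2 (by exact_mod_cast hkX₁)
  have hX₂ : (0 : ℝ) < X - k₂ := sub_pos.2 (by exact_mod_cast hkX₂)
  obtain ⟨x₀, y₀, hxy₀, h1, hl⟩ := hC _ hsq
  have hl' : log (x₀ + y₀ * √(k₁ * k₂ : ℕ)) ≤ s ^ 105 := by
    have hD : (((k₁ * k₂ : ℕ) : ℝ)) ^ ((51 : ℝ) / 100) ≤ s ^ 102 := by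
      calc (((k₁ * k₂ : ℕ) : ℝ)) ^ ((51 : ℝ) / 100) ≤ (s ^ 200) ^ ((51 : ℝ) / 100) := by
            gcongr
            push_cast
            calc (k₁ : ℝ) * k₂ ≤ s ^ 100 * s ^ 100 := by gcongr
              _ = _ := by ring
        _ = s ^ 102 := by
            rw [← rpow_natCast, ← rpow_mul hs0.le, ← rpow_natCast]
            norm_num
    calc _ ≤ _ := hl
      _ ≤ s * s ^ 102 := by
        gcongr
      _ = s ^ 103 := by ring
      _ ≤ s ^ 105 := pow_le_pow_right₀ hs1 (by norm_num)
  obtain ⟨x, y, hxy, hpos, hl1, hl2⟩ := exists_unit_log_mem_Icc hxy₀ h1 hl'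
  have hnorm : (k₂ * b₁) ^ 2 - ((k₁ * k₂ : ℕ) : ℤ) * b₂ ^ 2 = k₁ * k₂ ^ 2 * (k₂ - k₁) := by
    push_cast
    rw [mul_pow, h₁, h₂]
    ring
  have hbi : ∀ {k : ℕ} {b : ℤ}, b ^ 2 = k * (X - k) → 0 < b → (b : ℝ) = √k * √(X - k) := by
    intro k b h hb
    rw [← sqrt_mul (Nat.cast_nonneg k), eq_comm, sqrt_eq_iff_mul_self_eq_of_pos (by exact_mod_cast hb),
      ← sq]
    exact_mod_cast h
  have hβ : ((k₂ * b₁ : ℤ) : ℝ) + b₂ * √(k₁ * k₂ : ℕ) = √k₁ * k₂ * (√(X - k₁) + √(X - k₂)) := by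
    have h3 : √(k₂ : ℝ) * √k₂ = k₂ := mul_self_sqrt (Nat.cast_nonneg _)
    push_cast
    rw [hbi h₁ hb₁, hbi h₂ hb₂, sqrt_mul (Nat.cast_nonneg k₁)]
    linear_combination √(X - k₂ : ℝ) * √k₁ * h3
  have hr₁ : 1 ≤ √(k₁ : ℝ) := one_le_sqrt.2 hk₁1
  have hr₁' : √(k₁ : ℝ) ≤ k₁ := by
    have := mul_self_sqrt (Nat.cast_nonneg k₁ : (0 : ℝ) ≤ k₁)
    nlinarith
  have ht₁ := sqrt_pos.2 hX₁
  have ht₂ := sqrt_pos.2 hX₂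
  have hXi : ∀ k : ℕ, k < X → 1 ≤ √((X : ℝ) - k) ∧ √((X : ℝ) - k) ≤ exp (s ^ 350 / 2) := by
    intro k hk
    constructor
    · rw [one_le_sqrt]
      have : (k : ℝ) + 1 ≤ X := by exact_mod_cast hk
      linarith
    · rw [sqrt_le_left (exp_pos _).le, ← exp_nat_mul]
      push_cast
      rw [mul_div_cancel₀ _ (two_ne_zero)]
      have := Nat.cast_nonneg (α := ℝ) k
      linarith
  have hβ1 : 1 ≤ √k₁ * k₂ * (√(X - k₁) + √(X - k₂)) := by
    calc (1 : ℝ) = 1 * 1 * (1 + 0) := by norm_num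
      _ ≤ _ := by
        gcongr
        exact (hXi k₁ hkX₁).1
  have hβ2 : √k₁ * k₂ * (√(X - k₁) + √(X - k₂)) ≤ exp (s ^ 350 / 2 + (201 : ℕ) * log s) := by
    calc √k₁ * k₂ * (√(X - k₁) + √(X - k₂)) ≤
        s ^ 100 * s ^ 100 * (exp (s ^ 350 / 2) + exp (s ^ 350 / 2)) := by
          gcongr
          · exact hr₁'.trans hk₁s
          · exact (hXi k₁ hkX₁).2
          · exact (hXi k₂ hkX₂).2
      _ = 2 * s ^ 200 * exp (s ^ 350 / 2) := by ring
      _ ≤ s * s ^ 200 * exp (s ^ 350 / 2) := by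
        gcongr
        linarith
      _ = _ := by
        rw [exp_add, ← hexp]
        ring
  have hsub : (k₂ : ℤ) - k₁ ≠ 0 := sub_ne_zero.2 (by exact_mod_cast hne.symm)
  obtain ⟨γ, e, a, hγ, he, hγo, heo, hlog, ha⟩ := exists_reduced_multiple hvS hv hvo hH1 hxy hpos
    hl1 hl2 (A := k₂ * b₁) (B := b₂) (by rw [hnorm]; positivity) (by
      rw [hnorm]
      push_cast
      rw [abs_mul, abs_of_nonneg (by positivity)]
      calc (k₁ : ℝ) * k₂ ^ 2 * |(k₂ : ℝ) - k₁| ≤ s ^ 100 * (s ^ 100) ^ 2 * s ^ 100 := by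
            gcongr
            rw [abs_le]
            constructor <;> linarith
        _ = s ^ 400 := by ring
        _ = exp ((400 : ℕ) * log s) := hexp _
        _ ≤ _ := by
          rw [exp_le_exp]
          push_cast
          have : s ≤ s ^ 105 := le_self_pow₀ hs1 (by norm_num)
          linarith) (by rw [hβ]; linarith)
  rw [hβ] at hlog ha
  refine ⟨γ, e, a, hγ, he, hγo, heo, ?_, ha.trans ?_⟩
  · rw [← hlog, log_mul (by positivity) (by positivity), log_mul (by positivity) (by positivity)]
  · rw [abs_of_nonneg (log_nonneg hβ1)]
    have h3 : log (√k₁ * k₂ * (√(X - k₁) + √(X - k₂))) ≤ s ^ 350 / 2 + (201 : ℕ) * log s :=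
      (log_le_iff_le_exp (by linarith)).2 hβ2
    have h4 : s ≤ s ^ 245 := le_self_pow₀ hs1 (by norm_num)
    have h5 : s ^ 350 = s ^ 245 * s ^ 105 := by ring
    have h6 : log (√k₁ * k₂ * (√(X - k₁) + √(X - k₂))) / s ^ 105 ≤ s ^ 245 / 2 + s / 4 := by
      rw [div_le_iff₀ (by positivity)]
      refine h3.trans ?_
      rw [h5]
      push_cast
      have : s / 4 * 1 ≤ s / 4 * s ^ 105 := by gcongr
      linarith
    linarith

theorem false_of_three_points {C : ℝ}
    (hC : ∀ D : ℕ, ¬IsSquare (D : ℤ) → ∃ x y : ℤ, |x ^ 2 - D * y ^ 2| = 1 ∧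
      1 < x + y * √(D : ℝ) ∧ log (x + y * √(D : ℝ)) ≤ C * (D : ℝ) ^ ((51 : ℝ) / 100))
    {s : ℝ} (hs : 10 ^ 9 ≤ s) (hls : log s ≤ s / 10 ^ 6) (hCs : C ≤ s) {X : ℕ}
    (hX₀ : 2 * exp (2 * s ^ 346) ≤ X) (hX : (X : ℝ) ≤ exp (s ^ 350)) {k : Fin 3 → ℕ}
    {b : Fin 3 → ℤ} (hkinj : Function.Injective k) (hb : ∀ i, b i ^ 2 = k i * (X - k i))
    (hb0 : ∀ i, 0 < b i) (hk0 : ∀ i, 0 < k i) (hks : ∀ i, (k i : ℝ) ≤ s ^ 100) : False := by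
  have hs1 : 1 ≤ s := le_trans (by norm_num) hs
  have hs0 : 0 < s := by linarith
  have hexp : ∀ j : ℕ, s ^ j = exp (j * log s) := fun j => by
    rw [← log_pow, exp_log (by positivity)]
  have hs346 : s ≤ s ^ 346 := le_self_pow₀ hs1 (by norm_num)
  have hE : s ^ 100 ≤ exp (s ^ 346) := by
    rw [hexp, exp_le_exp]
    push_cast
    linarith
  have hE1 : 1 < exp (s ^ 346) := one_lt_exp_iff.2 (by positivity)
  rw [two_mul (s ^ 346), exp_add] at hX₀
  set E := exp (s ^ 346) with hEdef
  have hEE : E < E * E := by nlinarith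
  have hXk : ∀ i, E * E ≤ X - k i := fun i => by
    have := hks i
    linarith
  have hXk0 : ∀ i, (0 : ℝ) < X - k i := fun i => by
    have := hXk i
    linarith
  have hkX : ∀ i, k i < X := fun i => by exact_mod_cast sub_pos.1 (hXk0 i)
  have ht : ∀ i, E ≤ √(X - k i) := fun i => le_sqrt_of_sq_le (by rw [sq]; exact hXk i)
  have hkk : ∀ i j, |(k i : ℝ) - k j| ≤ s ^ 100 := fun i j => by
    have h1 := hks i
    have h2 := hks j
    have h3 := Nat.cast_nonneg (α := ℝ) (k i)
    have h4 := Nat.cast_nonneg (α := ℝ) (k j)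
    rw [abs_le]
    constructor <;> linarith
  have hnsq : ∀ i j, i ≠ j → ¬IsSquare ((k i * k j : ℕ) : ℤ) := by
    intro i j hij
    push_cast
    refine not_isSquare_mul_of_sq_eq (hb i) (hb j) (by exact_mod_cast hk0 i)
      (by exact_mod_cast hk0 j) (by exact_mod_cast hkinj.ne hij) ?_
    have h1 : ((k i : ℝ) - k j) ^ 2 < 2 * (2 * X - k i - k j) - 1 := by
      have h2 : ((k i : ℝ) - k j) ^ 2 ≤ E ^ 2 := by
        rw [← sq_abs]
        gcongr
        exact (hkk i j).trans hE
      have := hXk i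
      have := hXk j
      linarith
    exact_mod_cast h1
  set D := k 0 * k 1 with hD
  set F := k 0 * k 2 with hF
  have hDsq : ¬IsSquare (D : ℤ) := hnsq 0 1 (by decide)
  have hFsq : ¬IsSquare (F : ℤ) := hnsq 0 2 (by decide)
  have hDF : ¬IsSquare ((D : ℤ) * F) := by
    have h1 : (D : ℤ) * F = (k 0 : ℤ) ^ 2 * ((k 1 * k 2 : ℕ) : ℤ) := by
      rw [hD, hF]
      push_cast
      ring
    rw [h1]
    exact not_isSquare_sq_mul (by exact_mod_cast (hk0 0).ne') (hnsq 1 2 (by decide))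
  have hS := hasNormGeOne_biquadraticSubring hDsq hFsq hDF
  have hsign : ∀ (c : Bool) (r : ℝ), boolSign c * r = r ∨ boolSign c * r = -r := by
    intro c r
    cases c <;> simp [boolSign]
  obtain ⟨γ, e, a, hγ, he, hγo, heo, hlog, ha⟩ := exists_reduced_sqrt_add_sqrt hC hs hls hCs
    (S := biquadraticSubring D F) (o := (true, true)) (hb 0) (hb 1) (hb0 0) (hb0 1) (hk0 0) (hk0 1)
    (hkinj.ne (by decide)) (hks 0) (hks 1) (hkX 0) (hkX 1) hX hDsq
    (v := fun i => boolSign i.1 * √D) ⟨0, 1, 0, 0, by simp⟩ (fun i => hsign _ _)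
    (by simp [boolSign, hD])
  obtain ⟨δ, f, c, hδ, hf, hδo, hfo, hlog', hc⟩ := exists_reduced_sqrt_add_sqrt hC hs hls hCs
    (S := biquadraticSubring D F) (o := (true, true)) (hb 0) (hb 2) (hb0 0) (hb0 2) (hk0 0) (hk0 2)
    (hkinj.ne (by decide)) (hks 0) (hks 2) (hkX 0) (hkX 2) hX hFsq
    (v := fun i => boolSign i.2 * √F) ⟨0, 0, 1, 0, by simp⟩ (fun i => hsign _ _)
    (by simp [boolSign, hF])
  have hH : s ≤ s ^ 105 := le_self_pow₀ hs1 (by norm_num)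
  have hnat : ∀ i, HeightLE (biquadraticSubring D F) (s ^ 105) (k i : Bool × Bool → ℝ) := by
    intro i
    refine HeightLE.natCast (hk0 i).ne' ((hks i).trans ?_)
    rw [hexp 100, exp_le_exp]
    push_cast
    linarith
  have hk0' : ∀ i, (0 : ℝ) < k i := fun i => by exact_mod_cast hk0 i
  have hx := ((hγ.mul hδ.inv).mul ((hnat 2).mul (hnat 1).inv)).mono
    (by linarith : _ ≤ 7 * s ^ 105)
  set x : Bool × Bool → ℝ := γ * δ⁻¹ * (k 2 * (k 1 : Bool × Bool → ℝ)⁻¹) with hxdef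
  have hxo : x (true, true) = γ (true, true) * (δ (true, true))⁻¹ * (k 2 * (k 1 : ℝ)⁻¹) := by
    simp [hxdef]
  have hxo0 : 0 < x (true, true) := by
    rw [hxo]
    have := hk0' 1
    have := hk0' 2
    positivity
  have hlx : log (x (true, true)) = log (γ (true, true)) - log (δ (true, true)) +
      (log (k 2) - log (k 1)) := by
    have h1 := (hk0' 1).ne'
    have h2 := (hk0' 2).ne'
    rw [hxo, log_mul (by positivity) (by positivity), log_mul (by positivity) (by positivity),
      log_mul h2 (by positivity), log_inv, log_inv]
    ring
  have hΛ : log (x (true, true)) + a * log (e (true, true)) + (-c : ℤ) * log (f (true, true)) =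
      log (√(X - k 0) + √(X - k 1)) - log (√(X - k 0) + √(X - k 2)) := by
    rw [hlx]
    push_cast
    linear_combination hlog - hlog'
  have hst : ∀ i, 1 ≤ √((X : ℝ) - k 0) + √(X - k i) := fun i => by
    have := ht 0
    have := ht i
    linarith
  refine false_of_small_three_term_form (by simp) hS hs hls hx (he.mono (by linarith))
    (hf.mono (by linarith)) hxo0 heo hfo ha (b := -c) (by simpa using hc) ?_ ?_
  · rw [hΛ, sub_ne_zero]
    intro h
    have h1 := log_injOn_pos (Set.mem_Ioi.2 (by linarith [hst 1])) (Set.mem_Ioi.2 (by linarith [hst 2])) h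
    have h2 := (sqrt_inj (hXk0 1).le (hXk0 2).le).1 (add_left_cancel h1)
    have h3 : (k 1 : ℝ) = k 2 := by linarith
    exact hkinj.ne (by decide : (1 : Fin 3) ≠ 2) (by exact_mod_cast h3)
  · rw [hΛ]
    calc _ ≤ _ := abs_log_sub_log_le (hst 1) (hst 2)
      _ = |√(X - k 1) - √(X - k 2)| := by rw [add_sub_add_left_eq_sub]
      _ ≤ _ := abs_sqrt_sub_sqrt_le (hXk0 1) (hXk0 2)
      _ ≤ s ^ 100 / E := by
        gcongr
        · rw [sub_sub_sub_cancel_left]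
          exact hkk 2 1
        · exact ht 1
      _ = exp ((100 : ℕ) * log s - s ^ 346) := by rw [exp_sub, ← hexp]
      _ ≤ exp (-s ^ 345) := by
        rw [exp_le_exp]
        push_cast
        have h1 : 10 ^ 9 * s ^ 345 ≤ s ^ 346 := by
          rw [pow_succ' s 345]
          gcongr
        have h2 : s ≤ s ^ 345 := le_self_pow₀ hs1 (by norm_num)
        linarith

theorem eventually_rpow_log_large (C : ℝ) : ∃ n₀ : ℕ, ∀ n : ℕ, n₀ ≤ n →
    10 ^ 9 ≤ log n ^ ((1 : ℝ) / 350) ∧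
      log (log n ^ ((1 : ℝ) / 350)) ≤ log n ^ ((1 : ℝ) / 350) / 10 ^ 6 ∧
      C ≤ log n ^ ((1 : ℝ) / 350) := by
  have h1 : Filter.Tendsto (fun n : ℕ => log n ^ ((1 : ℝ) / 350)) Filter.atTop Filter.atTop :=
    (tendsto_rpow_atTop (by norm_num)).comp (tendsto_log_atTop.comp tendsto_natCast_atTop_atTop)
  have h2 : ∀ᶠ s : ℝ in Filter.atTop, log s ≤ s / 10 ^ 6 := by
    filter_upwards [isLittleO_log_id_atTop.bound (by norm_num : (0 : ℝ) < 1 / 10 ^ 6),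
      Filter.eventually_ge_atTop 0] with s hs hs0
    rw [id, norm_of_nonneg hs0] at hs
    refine (le_abs_self _).trans (hs.trans_eq ?_)
    ring
  obtain ⟨n₀, hn₀⟩ := Filter.eventually_atTop.1 (h1.eventually
    ((Filter.eventually_ge_atTop (10 ^ 9)).and (h2.and (Filter.eventually_ge_atTop C))))
  exact ⟨n₀, hn₀⟩

theorem ncard_le_ten_of_forall_eq {N : ℕ} {A : Set (ℤ × ℤ)}
    (hA : ∀ p ∈ A, p.1 ^ 2 + p.2 ^ 2 = (N : ℤ) ^ 2) {u w : ℕ}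
    (h : ∀ p ∈ A, p.2.natAbs = 0 ∨ p.2.natAbs = u ∨ p.2.natAbs = w) : A.ncard ≤ 10 := by
  classical
  let r : ℕ → ℤ := fun v => Nat.sqrt (N ^ 2 - v ^ 2)
  let l : List (ℤ × ℤ) := [(N, 0), (-N, 0), (r u, u), (r u, -u), (-r u, u), (-r u, -u),
    (r w, w), (r w, -w), (-r w, w), (-r w, -w)]
  have hsub : A ⊆ (l.toFinset : Set (ℤ × ℤ)) := by
    rintro ⟨a, b⟩ hp
    have h1 := hA _ hp
    have h2 := h _ hp
    simp only at h1 h2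
    have h3 : (a.natAbs : ℤ) = r b.natAbs := by
      have h4 : a.natAbs ^ 2 + b.natAbs ^ 2 = N ^ 2 := by
        zify
        simpa using h1
      have h5 : N ^ 2 - b.natAbs ^ 2 = a.natAbs * a.natAbs := by
        rw [← h4, Nat.add_sub_cancel, sq]
      simp only [r]
      rw [h5, Nat.sqrt_eq]
    have h6 : r 0 = N := by simp [r]
    have ha := Int.natAbs_eq a
    have hb := Int.natAbs_eq b
    rw [h3] at ha
    rcases h2 with h2 | h2 | h2 <;> rw [h2] at ha hb <;> rcases ha with ha | ha <;>
      rcases hb with hb | hb <;> rw [ha, hb] <;> simp [l, h6]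
  calc A.ncard ≤ (l.toFinset : Set (ℤ × ℤ)).ncard := Set.ncard_le_ncard hsub (Finset.finite_toSet _)
    _ = l.toFinset.card := Set.ncard_coe_finset _
    _ ≤ l.length := List.toFinset_card_le _
    _ = 10 := rfl

theorem ncard_le_ten_of_not_injective {N : ℕ} {A : Set (ℤ × ℤ)}
    (hA : ∀ p ∈ A, p.1 ^ 2 + p.2 ^ 2 = (N : ℤ) ^ 2)
    (h : ∀ p : Fin 3 → ℤ × ℤ, (∀ i, p i ∈ A) → (∀ i, (p i).2 ≠ 0) →
      ¬Function.Injective fun i => (p i).2.natAbs) : A.ncard ≤ 10 := by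
  by_contra! hcon
  have key : ∀ u w : ℕ, ∃ p ∈ A, p.2.natAbs ≠ 0 ∧ p.2.natAbs ≠ u ∧ p.2.natAbs ≠ w := by
    intro u w
    by_contra! h'
    refine hcon.not_ge (ncard_le_ten_of_forall_eq hA (u := u) (w := w) fun p hp => ?_)
    have := h' p hp
    tauto
  obtain ⟨p₀, hp₀, h0, -⟩ := key 0 0
  obtain ⟨p₁, hp₁, h1, h10, -⟩ := key p₀.2.natAbs 0
  obtain ⟨p₂, hp₂, h2, h20, h21⟩ := key p₀.2.natAbs p₁.2.natAbs
  refine h ![p₀, p₁, p₂] ?_ ?_ ?_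
  · intro i
    fin_cases i <;> assumption
  · intro i
    fin_cases i
    exacts [Int.natAbs_ne_zero.1 h0, Int.natAbs_ne_zero.1 h1, Int.natAbs_ne_zero.1 h2]
  · intro i j hij
    fin_cases i <;> fin_cases j <;> simp_all

/-- For sufficiently large perfect squares `n = N ^ 2`, the circle `a ^ 2 + b ^ 2 = n`
has at most ten lattice points with `|b| < n^(1/4) (log n)^(1/7)`. -/
theorem perfect_square_circle_lattice_points :
    ∃ n₀ : ℕ, ∀ n N : ℕ, n = N ^ 2 → n₀ ≤ n →
      {p : ℤ × ℤ | p.1 ^ 2 + p.2 ^ 2 = (n : ℤ) ∧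
        (|p.2| : ℝ) < (n : ℝ) ^ ((1 : ℝ) / 4) * (Real.log n) ^ ((1 : ℝ) / 7)}.ncard
        ≤ 10 := by
  obtain ⟨C, hC⟩ := exists_pell_unit_log_le (by norm_num : (0 : ℝ) < 1 / 200)
  norm_num only at hC
  obtain ⟨n₀, hn₀⟩ := eventually_rpow_log_large C
  refine ⟨max n₀ 4, fun n N hnN hn => ?_⟩
  obtain ⟨hs, hls, hCs⟩ := hn₀ n ((le_max_left _ _).trans hn)
  have hn4 : 4 ≤ n := (le_max_right _ _).trans hn
  have hN2 : 2 ≤ N := by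
    by_contra! h
    interval_cases N <;> omega
  have hlog : 0 ≤ log n := log_natCast_nonneg n
  have hs350 : (log n ^ ((1 : ℝ) / 350)) ^ 350 = log n := by
    rw [← rpow_natCast, ← rpow_mul hlog]
    norm_num
  have hs50 : (log n ^ ((1 : ℝ) / 350)) ^ 50 = log n ^ ((1 : ℝ) / 7) := by
    rw [← rpow_natCast, ← rpow_mul hlog]
    norm_num
  rw [← hs50]
  set s := log n ^ ((1 : ℝ) / 350)
  have hs1 : 1 ≤ s := le_trans (by norm_num) hs
  have hs0 : 0 < s := by linarith
  have hN0 : (0 : ℝ) < N := by exact_mod_cast (by omega : 0 < N)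
  have hnexp : (n : ℝ) = exp (s ^ 350) := by
    rw [hs350, exp_log (by exact_mod_cast (by omega : 0 < n))]
  have hnN' : (n : ℝ) = (N : ℝ) ^ 2 := by exact_mod_cast hnN
  refine ncard_le_ten_of_not_injective (N := N) ?_ ?_
  · rintro p ⟨hp, -⟩
    rw [hp, hnN]
    norm_cast
  intro p hp hp0 hinj
  have hp1 : ∀ i, |(p i).1| ^ 2 + |(p i).2| ^ 2 = (N : ℤ) ^ 2 := fun i => by
    rw [sq_abs, sq_abs, (hp i).1, hnN]
    norm_cast
  have hlt : ∀ i, (p i).1.natAbs < N := fun i => by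
    have h1 := hp1 i
    have h2 := abs_pos.2 (hp0 i)
    zify
    refine lt_of_pow_lt_pow_left₀ 2 (by positivity) ?_
    have h3 : 0 < |(p i).2| ^ 2 := by positivity
    linarith
  let k : Fin 3 → ℕ := fun i => N - (p i).1.natAbs
  have hk : ∀ i, (k i : ℤ) = N - |(p i).1| := fun i => by
    rw [Nat.cast_sub (hlt i).le, Int.natCast_natAbs]
  have hb : ∀ i, |(p i).2| ^ 2 = k i * ((2 * N : ℕ) - k i) := fun i => by
    rw [hk]
    push_cast
    linear_combination hp1 i
  refine false_of_three_points hC hs hls hCs (X := 2 * N) ?_ ?_ (k := k)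
    (b := fun i => |(p i).2|) ?_ hb (fun i => abs_pos.2 (hp0 i)) (fun i => Nat.sub_pos_of_lt (hlt i))
    fun i => ?_
  · push_cast
    gcongr
    refine (sq_le_sq₀ (exp_pos _).le hN0.le).1 ?_
    rw [← hnN', hnexp, ← exp_nat_mul, exp_le_exp]
    calc _ = 4 * s ^ 346 := by push_cast; ring
      _ ≤ s * s ^ 346 := by gcongr; linarith
      _ = s ^ 347 := by ring
      _ ≤ s ^ 350 := pow_le_pow_right₀ hs1 (by norm_num)
  · rw [← hnexp, hnN']
    push_cast
    have : (2 : ℝ) ≤ N := by exact_mod_cast hN2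
    nlinarith
  · intro i j hij
    apply hinj
    have h1 := hb i
    rw [hij, ← hb j, sq_eq_sq₀ (abs_nonneg _) (abs_nonneg _)] at h1
    exact Int.natAbs_eq_natAbs_iff.2 (abs_eq_abs.1 h1)
  · have h1 := (hp i).2
    have h2 : (k i : ℝ) * N ≤ (|(p i).2| : ℝ) ^ 2 := by
      have h3 : (k i : ℤ) * N ≤ |(p i).2| ^ 2 := by
        rw [hb i]
        have := hk i
        have := abs_nonneg (p i).1
        gcongr
        push_cast
        omega
      exact_mod_cast h3
    have h4 : ((n : ℝ) ^ ((1 : ℝ) / 4) * s ^ 50) ^ 2 = s ^ 100 * N := by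
      have h5 : ((n : ℝ) ^ ((1 : ℝ) / 4)) ^ 2 = N := by
        rw [hnN', ← rpow_natCast, ← rpow_natCast, ← rpow_mul hN0.le, ← rpow_mul hN0.le]
        norm_num
      rw [mul_pow, h5]
      ring
    have h6 : (|(p i).2| : ℝ) ^ 2 ≤ ((n : ℝ) ^ ((1 : ℝ) / 4) * s ^ 50) ^ 2 := by gcongr
    rw [h4] at h6
    exact le_of_mul_le_mul_right (h2.trans h6) hN0
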